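/- arXiv:1504.06037 — 2 statements merged into one kernel-verified Lean document; each statement's English description precedes it below -/
import Mathlib

section
/- Let (R, 𝔪) be an unmixed Noetherian local ring of dimension d ≥ 2 with infinite residue field. Then the following are equivalent: (i) R is Cohen–Macaulay; (ii) for every parameter ideal 𝔮 ⊆ 𝔪², 𝒩(𝔮;R) = e₁(𝔮:𝔪) − e₁(𝔮); (iii) for every parameter ideal 𝔮 ⊆ 𝔪², 𝒩(𝔮;R) ≤ e₁(𝔮:𝔪) − e₁(𝔮). -/
open CategoryTheory IsLocalRing

noncomputable section

/-- The length of a module, defined as the Krull dimension of its submodule lattice. -/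
def moduleLength (R M : Type) [CommRing R] [AddCommGroup M] [Module R M] : WithBot ℕ∞ :=
  Order.krullDim (Submodule R M)

variable (R : Type) [CommRing R] [IsLocalRing R]

/-- `q` is a parameter ideal of the `d`-dimensional local ring `R`:
it is generated by `d` elements and is `𝔪`-primary (its radical is `𝔪`). -/
def IsParameterIdeal (d : ℕ) (q : Ideal R) : Prop :=
  (∃ x : Fin d → R, q = Ideal.span (Set.range x)) ∧ q.radical = maximalIdeal R

/-- `e` is the sequence of Hilbert coefficients of the `𝔪`-primary ideal `I`:
for all large `n`, `ℓ(R/Iⁿ⁺¹) = Σ_{i=0}^d (-1)^i e_i C(n+d-i, d-i)`. -/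
def IsHilbertCoeffs (d : ℕ) (I : Ideal R) (e : ℕ → ℤ) : Prop :=
  ∃ N : ℕ, ∀ n ≥ N, ∃ L : ℕ,
    moduleLength R (R ⧸ I ^ (n + 1)) = (L : ℕ∞) ∧
    (L : ℤ) = ∑ i ∈ Finset.range (d + 1),
      (-1 : ℤ) ^ i * e i * ((n + d - i).choose (d - i) : ℤ)

/-- The index of reducibility `𝒩(q;R) = ℓ_R((q :_R 𝔪)/q)`. -/
def indexOfReducibility (q : Ideal R) : WithBot ℕ∞ :=
  moduleLength R
    (↥(q.colon (maximalIdeal R)) ⧸ (Submodule.comap (q.colon (maximalIdeal R)).subtype q))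

/-- `R` is unmixed of dimension `d`: `dim (R̂/P) = d` for every associated prime `P`
of the `𝔪`-adic completion `R̂` of `R`. -/
def IsUnmixed (d : ℕ) : Prop :=
  ∀ P ∈ associatedPrimes (AdicCompletion (maximalIdeal R) R) (AdicCompletion (maximalIdeal R) R),
    ringKrullDim ((AdicCompletion (maximalIdeal R) R) ⧸ P) = (d : WithBot ℕ∞)

/-- The depth of a local ring `A`, as the least `i` such that `Ext^i(k, A) ≠ 0`. -/
def extDepth (A : Type) [CommRing A] [IsLocalRing A] : ℕ∞ :=
  sInf {n : ℕ∞ | ∃ m : ℕ, n = (m : ℕ∞) ∧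
    Nontrivial (((Ext A (ModuleCat A) m).obj
      (Opposite.op (ModuleCat.of A (ResidueField A)))).obj (ModuleCat.of A A))}

/-- A local ring is Cohen–Macaulay if its depth equals its Krull dimension. -/
def IsCohenMacaulay (A : Type) [CommRing A] [IsLocalRing A] : Prop :=
  (extDepth A : WithBot ℕ∞) = ringKrullDim A

/-- The Cohen–Macaulay type `r(R) = ℓ_R(Ext^d_R(R/𝔪, R))`. -/
def cmType (d : ℕ) : WithBot ℕ∞ :=
  moduleLength R (((Ext R (ModuleCat R) d).obj
      (Opposite.op (ModuleCat.of R (R ⧸ maximalIdeal R)))).obj (ModuleCat.of R R))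

/-- `f` is the sequence of coefficients of the polynomial that agrees with
`n ↦ ℓ((Iⁿ :_R 𝔪)/Iⁿ)` for all large `n`; `f 0` is the irreducible multiplicity `f₀(I)`. -/
def IsIrrCoeffs (d : ℕ) (I : Ideal R) (f : ℕ → ℤ) : Prop :=
  ∃ N : ℕ, ∀ n ≥ N, ∃ L : ℕ,
    indexOfReducibility R (I ^ n) = (L : ℕ∞) ∧
    (L : ℤ) = ∑ i ∈ Finset.range d,
      (-1 : ℤ) ^ i * f i * ((n + (d - 1) - i).choose (d - 1 - i) : ℤ)

/-- `R` is a generalized Cohen–Macaulay ring of dimension `d`: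
the local cohomology modules `H^i_𝔪(R)` have finite length for all `i < d`. -/
def IsGeneralizedCM (d : ℕ) : Prop :=
  ∀ i < d, ∃ L : ℕ,
    moduleLength R ↥((localCohomology (maximalIdeal R) i).obj (ModuleCat.of R R)) = (L : ℕ∞)

/-- `r_i(R) = dim_k ((0) :_{H^i_𝔪(R)} 𝔪)`, the length of the socle of the `i`-th
local cohomology module of `R`. -/
def socLocalCohomology (i : ℕ) : WithBot ℕ∞ :=
  moduleLength R
    ↥(Submodule.torsionBySet R ↥((localCohomology (maximalIdeal R) i).obj (ModuleCat.of R R))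
      (maximalIdeal R : Set R))

/-- A system of parameters `x₁, …, x_d` is standard if
`𝔮·H^i_𝔪(R/(x₁,…,x_j)R) = 0` for all `i + j < d`, where `𝔮 = (x₁,…,x_d)`. -/
def IsStandardSOP (d : ℕ) (x : Fin d → R) : Prop :=
  (Ideal.span (Set.range x)).radical = maximalIdeal R ∧
  ∀ i j : ℕ, i + j < d →
    ∀ a ∈ Ideal.span (Set.range x),
      ∀ v : ((localCohomology (maximalIdeal R) i).obj
        (ModuleCat.of R (R ⧸ Ideal.span (x '' {k : Fin d | (k : ℕ) < j})))), a • v = 0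

/-- `R` is a regular local ring of dimension `d`: `𝔪` is generated by `d` elements. -/
def IsRegularLocal (d : ℕ) : Prop :=
  ∃ x : Fin d → R, maximalIdeal R = Ideal.span (Set.range x)

/-- `R` is Gorenstein: `R` is Cohen–Macaulay of Cohen–Macaulay type `r(R) = 1`. -/
def IsGorenstein (d : ℕ) : Prop :=
  IsCohenMacaulay R ∧ cmType R d = 1

section Tower

variable {A : Type} [CommRing A]

/-- The ideal generated by the first `n` terms of the sequence `x`. -/
def partialIdeal (x : ℕ → A) (n : ℕ) : Ideal A :=
  Ideal.span (x '' Set.Iio n)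

lemma partialIdeal_zero (x : ℕ → A) : partialIdeal x 0 = ⊥ := by
  simp [partialIdeal]

lemma partialIdeal_succ (x : ℕ → A) (n : ℕ) :
    partialIdeal x (n + 1) = partialIdeal x n ⊔ Ideal.span {x n} := by
  rw [partialIdeal, partialIdeal, ← Ideal.span_union]
  congr 1
  ext y
  simp only [Set.mem_image, Set.mem_Iio, Set.mem_union, Set.mem_singleton_iff]
  constructor
  · rintro ⟨i, hi, rfl⟩
    rcases Nat.lt_succ_iff_lt_or_eq.mp hi with h | rfl
    · exact Or.inl ⟨i, h, rfl⟩
    · exact Or.inr rfl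
  · rintro (⟨i, hi, rfl⟩ | rfl)
    · exact ⟨i, by omega, rfl⟩
    · exact ⟨n, by omega, rfl⟩

lemma partialIdeal_mono (x : ℕ → A) : Monotone (partialIdeal x) :=
  monotone_nat_of_le_succ fun n => by rw [partialIdeal_succ]; exact le_sup_left

lemma mem_partialIdeal (x : ℕ → A) {i n : ℕ} (h : i < n) : x i ∈ partialIdeal x n :=
  Ideal.subset_span ⟨i, h, rfl⟩

lemma partialIdeal_eq_span_finset [DecidableEq A] (x : ℕ → A) (j : ℕ) :
    partialIdeal x j = Ideal.span ((Finset.range j).image x : Finset A) := by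
  rw [partialIdeal]
  congr 1
  ext
  simp

lemma Ideal.mem_sup_span_singleton_iff {I : Ideal A} {a y : A} :
    y ∈ I ⊔ Ideal.span {a} ↔ ∃ t ∈ I, ∃ r, y = t + a * r := by
  rw [Submodule.mem_sup]
  constructor
  · rintro ⟨t, ht, s, hs, rfl⟩
    obtain ⟨r, rfl⟩ := Ideal.mem_span_singleton'.mp hs
    exact ⟨t, ht, r, by ring⟩
  · rintro ⟨t, ht, r, rfl⟩
    exact ⟨t, ht, a * r, Ideal.mem_span_singleton.mpr ⟨r, rfl⟩, rfl⟩

lemma mem_partialIdeal_succ {x : ℕ → A} {n : ℕ} {y : A} :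
    y ∈ partialIdeal x (n + 1) ↔ ∃ t ∈ partialIdeal x n, ∃ r, y = t + x n * r := by
  rw [partialIdeal_succ, Ideal.mem_sup_span_singleton_iff]

lemma mem_partialIdeal_succ_mul {x : ℕ → A} {n : ℕ} {J : Ideal A} {y : A} :
    y ∈ partialIdeal x (n + 1) * J ↔
      ∃ t ∈ partialIdeal x n * J, ∃ r ∈ J, y = t + x n * r := by
  rw [partialIdeal_succ, Ideal.sup_mul, Submodule.mem_sup]
  constructor
  · rintro ⟨t, ht, s, hs, rfl⟩
    obtain ⟨r, hr, rfl⟩ := Ideal.mem_span_singleton_mul.mp hs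
    exact ⟨t, ht, r, hr, rfl⟩
  · rintro ⟨t, ht, r, hr, rfl⟩
    exact ⟨t, ht, x n * r, Ideal.mem_span_singleton_mul.mpr ⟨r, hr, rfl⟩, rfl⟩

/-- An increasing chain of ideals `U j ⊇ (x 0, …, x (j - 1))` such that `x j` is a nonzerodivisor
modulo `U j` and maps `U j` into `(x 0, …, x (j - 1))`. -/
structure IsTower (x : ℕ → A) (U : ℕ → Ideal A) (d : ℕ) : Prop where
  le : ∀ j < d, partialIdeal x j ≤ U j
  mono : ∀ i j, i ≤ j → j < d → U i ≤ U j
  cancel : ∀ j < d, ∀ r, x j * r ∈ U j → r ∈ U j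
  kill : ∀ j < d, ∀ u ∈ U j, x j * u ∈ partialIdeal x j

namespace IsTower

variable {x : ℕ → A} {U : ℕ → Ideal A} {d : ℕ} (h : IsTower x U d)
include h

lemma inf_partialIdeal_le {i k : ℕ} (hk : k ≤ d) :
    U i ⊓ partialIdeal x k ≤ partialIdeal x i := by
  induction k with
  | zero => rw [partialIdeal_zero]; simp
  | succ k ih =>
    rintro s ⟨hs, hs'⟩
    rcases lt_or_ge k i with hki | hki
    · exact partialIdeal_mono x hki hs'
    · obtain ⟨t, ht, r, rfl⟩ := mem_partialIdeal_succ.mp hs'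
      refine ih (by omega) ⟨hs, ?_⟩
      have h1 : x k * r ∈ U k := by
        have := (U k).sub_mem (h.mono i k hki (by omega) hs) (h.le k (by omega) ht)
        simpa using this
      exact add_mem ht (h.kill k (by omega) r (h.cancel k (by omega) r h1))

lemma inf_pow_mul_le {J : Ideal A} {q : Ideal A} (hq : q = partialIdeal x d)
    (h0 : ∀ i ≤ d, partialIdeal x i ⊓ q * J ≤ partialIdeal x i * J) (n : ℕ) :
    ∀ i ≤ d, partialIdeal x i ⊓ q * (q ^ n * J) ≤ partialIdeal x i * (q ^ n * J) := by
  induction n with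
  | zero => simpa using h0
  | succ n ih =>
    have key : ∀ k ≤ d, ∀ i ≤ k, partialIdeal x i ⊓ partialIdeal x k * (q ^ (n + 1) * J) ≤
        partialIdeal x i * (q ^ (n + 1) * J) := by
      intro k
      induction k with
      | zero =>
        rintro hk i hi y ⟨-, hy⟩
        obtain rfl : i = 0 := by omega
        exact hy
      | succ k ihk =>
        rintro hk i hi y ⟨hyi, hy⟩
        rcases Nat.lt_or_ge k i with hik | hik
        · obtain rfl : i = k + 1 := by omega
          exact hy
        refine ihk (by omega) i hik ⟨hyi, ?_⟩
        obtain ⟨t, ht, s, hs, rfl⟩ := mem_partialIdeal_succ_mul.mp hy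
        refine add_mem ht ?_
        have h1 : x k * s ∈ partialIdeal x k := by
          have := sub_mem (partialIdeal_mono x hik hyi) (Ideal.mul_le_left ht)
          simpa using this
        have h2 : s ∈ U k := h.cancel k (by omega) s (h.le k (by omega) h1)
        have hs' : s ∈ q * (q ^ n * J) := by rwa [← mul_assoc, ← pow_succ']
        have h3 : s ∈ partialIdeal x k :=
          h.inf_partialIdeal_le le_rfl ⟨h2, hq ▸ Ideal.mul_le_left hs'⟩
        have h4 := ih k (by omega) ⟨h3, hs'⟩
        have h5 : x k * s ∈ q * (partialIdeal x k * (q ^ n * J)) :=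
          Ideal.mul_mem_mul (hq ▸ mem_partialIdeal x (by omega)) h4
        rwa [← mul_assoc, mul_comm q, mul_assoc, ← mul_assoc q, ← pow_succ'] at h5
    intro i hi
    have := key d le_rfl i hi
    rwa [← hq] at this

lemma mem_mul_of_forall_mul_mem {M q I : Ideal A} (hq : q = partialIdeal x d)
    (hI : ∀ u, u ∈ I ↔ ∀ z ∈ M, z * u ∈ q)
    (hS : ∀ i < d, ∀ u, (∀ z ∈ M, z * u ∈ q ⊔ U i) → u ∈ I ⊔ U i) (i : ℕ) (hi : i ≤ d)
    (y : A) (hy : y ∈ partialIdeal x i) (hyz : ∀ z ∈ M, z * y ∈ partialIdeal x i * q) :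
    y ∈ partialIdeal x i * I := by
  induction i generalizing y with
  | zero =>
    rw [partialIdeal_zero] at *
    simpa using hy
  | succ i ih =>
    obtain ⟨t, ht, e, rfl⟩ := mem_partialIdeal_succ.mp hy
    have he : e ∈ I ⊔ U i := by
      refine hS i (by omega) e fun z hz => ?_
      obtain ⟨t', ht', s, hs, hzs⟩ := mem_partialIdeal_succ_mul.mp (hyz z hz)
      have h1 : x i * (z * e - s) ∈ U i := by
        have : x i * (z * e - s) = t' - z * t := by linear_combination hzs
        rw [this]
        exact h.le i (by omega) (sub_mem (Ideal.mul_le_left ht') (Ideal.mul_mem_left _ _ ht))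
      have h2 := h.cancel i (by omega) _ h1
      exact Submodule.mem_sup.mpr ⟨s, hs, _, h2, by ring⟩
    obtain ⟨e', he', u, hu, rfl⟩ := Submodule.mem_sup.mp he
    have ht1 : t + x i * u ∈ partialIdeal x i := add_mem ht (h.kill i (by omega) u hu)
    have base : ∀ i ≤ d, partialIdeal x i ⊓ q * ⊤ ≤ partialIdeal x i * (⊤ : Ideal A) := by
      intro i _; simp
    have h2 := ih (by omega) _ ht1 fun z hz => by
      have h3 := h.inf_pow_mul_le hq base 1 i (by omega)
      simp only [pow_one, Ideal.mul_top] at h3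
      refine h3 ⟨Ideal.mul_mem_left _ _ ht1, ?_⟩
      have h4 : z * (t + x i * u) = z * (t + x i * (e' + u)) - x i * (z * e') := by ring
      rw [h4]
      refine sub_mem (Ideal.mul_mono_left ?_ (hyz z hz)) (Ideal.mul_mem_mul ?_ ((hI e').mp he' z hz))
      · rw [hq]; exact partialIdeal_mono x hi
      · rw [hq]; exact mem_partialIdeal x (by omega)
    refine mem_partialIdeal_succ_mul.mpr ⟨_, h2, e', he', by ring⟩

lemma inf_mul_le {M q I : Ideal A} (hq : q = partialIdeal x d)
    (hI : ∀ u, u ∈ I ↔ ∀ z ∈ M, z * u ∈ q)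
    (hS : ∀ i < d, ∀ u, (∀ z ∈ M, z * u ∈ q ⊔ U i) → u ∈ I ⊔ U i) (i : ℕ) (hi : i ≤ d) :
    partialIdeal x i ⊓ q * I ≤ partialIdeal x i * I := by
  rintro y ⟨hy, hy'⟩
  refine h.mem_mul_of_forall_mul_mem hq hI hS i hi y hy fun z hz => ?_
  have h3 := h.inf_pow_mul_le (J := ⊤) hq (by intro i _; simp) 1 i (by omega)
  simp only [pow_one, Ideal.mul_top] at h3
  refine h3 ⟨Ideal.mul_mem_left _ _ hy, ?_⟩
  have hle : M * (q * I) ≤ q * q := by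
    rw [mul_left_comm]
    refine Ideal.mul_mono_right (Ideal.mul_le.mpr fun z hz u hu => (hI u).mp hu z hz)
  exact hle (Ideal.mul_mem_mul hz hy')

lemma mul_self_le {M q I : Ideal A} (hq : q = partialIdeal x d)
    (hI : ∀ u, u ∈ I ↔ ∀ z ∈ M, z * u ∈ q)
    (hS : ∀ i < d, ∀ u, (∀ z ∈ M, z * u ∈ q ⊔ U i) → u ∈ I ⊔ U i)
    (hIM : I ≤ M) (hM : M * I ≤ M * q) : I * I ≤ q * I := by
  have hMI : M * I ≤ q := hM.trans Ideal.mul_le_right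
  intro y hy
  have key := h.mem_mul_of_forall_mul_mem hq hI hS d le_rfl y
    (hq ▸ hMI (Ideal.mul_mono_left hIM hy)) fun z hz => by
      have hle : M * (I * I) ≤ q * q := by
        rw [← mul_assoc]
        refine (Ideal.mul_mono_left hM).trans ?_
        rw [mul_comm M q, mul_assoc]
        exact Ideal.mul_mono_right hMI
      rw [← hq]
      exact hle (Ideal.mul_mem_mul hz hy)
  rwa [← hq] at key

end IsTower

lemma Ideal.pow_succ_eq_of_mul_self_le {q I : Ideal A} (hqI : q ≤ I) (hII : I * I ≤ q * I) (n : ℕ) :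
    I ^ (n + 1) = q ^ n * I := by
  induction n with
  | zero => simp
  | succ n ih =>
    rw [pow_succ, ih, mul_assoc, le_antisymm hII (Ideal.mul_mono_left hqI), ← mul_assoc,
      ← pow_succ]

end Tower

section HilbertPolynomial

/-- The value at `n` of the polynomial of degree at most `D` with Hilbert coefficients `e`. -/
def hilbertValue (D : ℕ) (e : ℕ → ℤ) (n : ℕ) : ℤ :=
  ∑ i ∈ Finset.range (D + 1), (-1 : ℤ) ^ i * e i * ((n + D - i).choose (D - i) : ℤ)

lemma hilbertValue_succ_sub (D : ℕ) (e : ℕ → ℤ) (n : ℕ) :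
    hilbertValue (D + 1) e (n + 1) - hilbertValue (D + 1) e n = hilbertValue D e (n + 1) := by
  simp only [hilbertValue]
  rw [Finset.sum_range_succ _ (D + 1), Finset.sum_range_succ _ (D + 1)]
  simp only [Nat.sub_self, Nat.choose_zero_right]
  rw [add_sub_add_right_eq_sub, ← Finset.sum_sub_distrib]
  refine Finset.sum_congr rfl fun i hi => ?_
  have hi' : i ≤ D := by simpa [Nat.lt_succ_iff] using hi
  rw [show n + 1 + (D + 1) - i = n + 1 + D - i + 1 by omega,
    show D + 1 - i = D - i + 1 by omega, show n + (D + 1) - i = n + 1 + D - i by omega,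
    Nat.choose_succ_succ]
  push_cast
  ring

lemma hilbertValue_succ_eq_add (D : ℕ) (e : ℕ → ℤ) (n : ℕ) :
    hilbertValue (D + 1) e n =
      (∑ i ∈ Finset.range (D + 1),
        (-1 : ℤ) ^ i * e i * ((n + (D + 1) - i).choose (D + 1 - i) : ℤ)) +
        (-1) ^ (D + 1) * e (D + 1) := by
  simp [hilbertValue, Finset.sum_range_succ _ (D + 1)]

lemma eq_zero_of_hilbertValue_eq_zero {D N : ℕ} {e : ℕ → ℤ}
    (h : ∀ n ≥ N, hilbertValue D e n = 0) : ∀ i ≤ D, e i = 0 := by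
  induction D generalizing N with
  | zero =>
    intro i hi
    obtain rfl : i = 0 := by omega
    simpa [hilbertValue] using h N le_rfl
  | succ D ih =>
    have h1 : ∀ i ≤ D, e i = 0 := by
      refine ih (N := N + 1) fun n hn => ?_
      obtain ⟨n, rfl⟩ : ∃ k, n = k + 1 := ⟨n - 1, by omega⟩
      rw [← hilbertValue_succ_sub, h _ (by omega), h _ (by omega), sub_zero]
    intro i hi
    rcases Nat.lt_or_ge D i with hi' | hi'
    · obtain rfl : i = D + 1 := by omega
      have h2 := h N le_rfl
      rw [hilbertValue_succ_eq_add, Finset.sum_eq_zero, zero_add] at h2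
      · simpa using h2
      · intro j hj
        rw [h1 j (by simpa [Nat.lt_succ_iff] using hj)]
        simp
    · exact h1 i hi'

lemma hilbertValue_sub (D : ℕ) (e e' : ℕ → ℤ) (n : ℕ) :
    hilbertValue D (e - e') n = hilbertValue D e n - hilbertValue D e' n := by
  simp only [hilbertValue, ← Finset.sum_sub_distrib, Pi.sub_apply]
  exact Finset.sum_congr rfl fun i _ => by ring

lemma hilbertValue_unique {D N N' : ℕ} {f : ℕ → ℤ} {e e' : ℕ → ℤ}
    (h : ∀ n ≥ N, f n = hilbertValue D e n) (h' : ∀ n ≥ N', f n = hilbertValue D e' n) :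
    ∀ i ≤ D, e i = e' i := by
  intro i hi
  have := eq_zero_of_hilbertValue_eq_zero (D := D) (N := max N N') (e := e - e')
    (fun n hn => by
      rw [hilbertValue_sub, ← h n (le_trans (le_max_left _ _) hn),
        ← h' n (le_trans (le_max_right _ _) hn), sub_self]) i hi
  simpa [sub_eq_zero] using this

/-- Summing a function with Hilbert coefficients `e` changes only the last two coefficients. -/
lemma exists_hilbertValue_of_succ {D N : ℕ} {f g e : ℕ → ℤ} {u : ℤ}
    (hf : ∀ n ≥ N, f n = hilbertValue D e n)
    (hg : ∀ n ≥ N, g (n + 1) + u = g n + f (n + 1)) :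
    ∃ e' : ℕ → ℤ, (∀ n ≥ N, g n = hilbertValue (D + 1) e' n) ∧ (∀ i < D, e' i = e i) ∧
      e' D = e D - (-1) ^ D * u := by
  let e₁ : ℕ → ℤ := fun i => if i < D then e i else if i = D then e D - (-1) ^ D * u else 0
  let K : ℤ := g N - hilbertValue (D + 1) e₁ N
  let e' : ℕ → ℤ := fun i => if i ≤ D then e₁ i else (-1) ^ (D + 1) * K
  have hD : ∀ n, hilbertValue D e₁ n = hilbertValue D e n - u := by
    intro n
    simp only [hilbertValue, Finset.sum_range_succ _ D]
    have : ∑ i ∈ Finset.range D, (-1 : ℤ) ^ i * e₁ i * ((n + D - i).choose (D - i) : ℤ) =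
        ∑ i ∈ Finset.range D, (-1 : ℤ) ^ i * e i * ((n + D - i).choose (D - i) : ℤ) :=
      Finset.sum_congr rfl fun i hi => by simp [e₁, Finset.mem_range.mp hi]
    rw [this]
    have h2 : ((-1 : ℤ) ^ D) * (-1) ^ D = 1 := by rw [← mul_pow]; simp
    simp only [e₁, lt_irrefl, if_false, if_true, Nat.sub_self, Nat.choose_zero_right, Nat.cast_one]
    linear_combination (-u) * h2
  have hval : ∀ n, hilbertValue (D + 1) e' n = hilbertValue (D + 1) e₁ n + K := by
    intro n
    rw [hilbertValue_succ_eq_add, hilbertValue_succ_eq_add]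
    have : ∑ i ∈ Finset.range (D + 1),
          (-1 : ℤ) ^ i * e' i * ((n + (D + 1) - i).choose (D + 1 - i) : ℤ) =
        ∑ i ∈ Finset.range (D + 1),
          (-1 : ℤ) ^ i * e₁ i * ((n + (D + 1) - i).choose (D + 1 - i) : ℤ) :=
      Finset.sum_congr rfl fun i hi => by simp [e', Nat.lt_succ_iff.mp (Finset.mem_range.mp hi)]
    rw [this]
    have h2 : ((-1 : ℤ) ^ (D + 1)) * (-1) ^ (D + 1) = 1 := by rw [← mul_pow]; simp
    have h3 : e₁ (D + 1) = 0 := by simp [e₁]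
    have h4 : e' (D + 1) = (-1) ^ (D + 1) * K := by simp [e']
    rw [h3, h4]
    linear_combination K * h2
  refine ⟨e', fun n hn => ?_, fun i hi => by simp [e', e₁, hi, hi.le], by simp [e', e₁]⟩
  induction n, hn using Nat.le_induction with
  | base => rw [hval]; simp [K]
  | succ n hn ih =>
    have h1 := hilbertValue_succ_sub D e₁ n
    have h2 := hg n hn
    rw [hval] at ih ⊢
    rw [hD, ← hf (n + 1) (by omega)] at h1
    linear_combination h2 + ih - h1

lemma exists_hilbertValue_pair {d : ℕ} {g g' : ℕ → ℕ → ℤ} {u : ℕ → ℤ} {c : ℤ}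
    (hg : ∀ j < d, ∀ n ≥ 1, g j (n + 1) + u j = g j n + g (j + 1) (n + 1))
    (hg' : ∀ j < d, ∀ n ≥ 1, g' j (n + 1) + u j = g' j n + g' (j + 1) (n + 1))
    (hc : ∀ n ≥ 1, g d n = c) (hc' : ∀ n ≥ 1, g' d n = c) (D : ℕ) (hD : D + 1 ≤ d) :
    ∃ e e' : ℕ → ℤ, (∀ n ≥ 1, g (d - (D + 1)) n = hilbertValue (D + 1) e n) ∧
      (∀ n ≥ 1, g' (d - (D + 1)) n = hilbertValue (D + 1) e' n) ∧
      e' 1 - e 1 = g (d - 1) 1 - g' (d - 1) 1 := by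
  induction D with
  | zero =>
    have key : ∀ f : ℕ → ℕ → ℤ,
        (∀ j < d, ∀ n ≥ 1, f j (n + 1) + u j = f j n + f (j + 1) (n + 1)) →
        (∀ n ≥ 1, f d n = c) → ∃ e : ℕ → ℤ, (∀ n ≥ 1, f (d - 1) n = hilbertValue 1 e n) ∧
          e 1 = 2 * (c - u (d - 1)) - f (d - 1) 1 := by
      intro f hf hfc
      have hf1 : ∀ n ≥ 1, f (d - 1) (n + 1) = f (d - 1) n + (c - u (d - 1)) := by
        intro n hn
        have := hf (d - 1) (by omega) n hn
        rw [show d - 1 + 1 = d by omega, hfc (n + 1) (by omega)] at this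
        linear_combination this
      refine ⟨fun i => if i = 0 then c - u (d - 1) else 2 * (c - u (d - 1)) - f (d - 1) 1,
        fun n hn => ?_, by simp⟩
      induction n, hn using Nat.le_induction with
      | base => simp [hilbertValue, Finset.sum_range_succ]; ring
      | succ n hn ih =>
        rw [hf1 n hn, ih]
        simp [hilbertValue, Finset.sum_range_succ]
        ring
    obtain ⟨e, he, he1⟩ := key g hg hc
    obtain ⟨e', he', he1'⟩ := key g' hg' hc'
    exact ⟨e, e', he, he', by rw [he1, he1']; ring⟩
  | succ D ih =>
    obtain ⟨e, e', he, he', h1⟩ := ih (by omega)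
    have hj : d - (D + 1 + 1) + 1 = d - (D + 1) := by omega
    obtain ⟨E, hE, hE1, hE2⟩ := exists_hilbertValue_of_succ (u := u (d - (D + 1 + 1)))
      (g := g (d - (D + 1 + 1))) he fun n hn => by
        rw [← hj]; exact hg _ (by omega) n hn
    obtain ⟨E', hE', hE1', hE2'⟩ := exists_hilbertValue_of_succ (u := u (d - (D + 1 + 1)))
      (g := g' (d - (D + 1 + 1))) he' fun n hn => by
        rw [← hj]; exact hg' _ (by omega) n hn
    refine ⟨E, E', hE, hE', ?_⟩
    rw [← h1]
    rcases Nat.eq_zero_or_pos D with rfl | hD0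
    · rw [hE2, hE2']; ring
    · rw [hE1 1 (by omega), hE1' 1 (by omega)]

end HilbertPolynomial

section Lengths

variable {A : Type} [CommRing A]

lemma length_quotient_eq_of_colon {K L K' : Ideal A} (a : A) (h : ∀ r, a * r ∈ K ↔ r ∈ L)
    (hK : K' = K ⊔ Ideal.span {a}) :
    Module.length A (A ⧸ K) = Module.length A (A ⧸ L) + Module.length A (A ⧸ K') := by
  have hKK : K ≤ K' := hK ▸ le_sup_left
  refine Module.length_eq_add_of_exact
    (Submodule.mapQ L K (LinearMap.lsmul A A a) fun r hr => (h r).mpr hr)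
    (Submodule.mapQ K K' LinearMap.id hKK) ?_ ?_ ?_
  · rw [← LinearMap.ker_eq_bot, LinearMap.ker_eq_bot']
    intro y hy
    obtain ⟨r, rfl⟩ := Submodule.mkQ_surjective L y
    have hy' : (Submodule.Quotient.mk (a * r) : A ⧸ K) = 0 := hy
    rw [Submodule.Quotient.mk_eq_zero] at hy'
    exact (Submodule.Quotient.mk_eq_zero L).mpr ((h r).mp hy')
  · intro y
    obtain ⟨r, rfl⟩ := Submodule.mkQ_surjective K' y
    exact ⟨Submodule.Quotient.mk r, rfl⟩
  · intro y
    obtain ⟨r, rfl⟩ := Submodule.mkQ_surjective K y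
    simp only [Submodule.mkQ_apply, Submodule.mapQ_apply, Submodule.Quotient.mk_eq_zero,
      LinearMap.id_apply]
    rw [hK, Ideal.mem_sup_span_singleton_iff]
    constructor
    · rintro ⟨t, ht, s, rfl⟩
      refine ⟨Submodule.Quotient.mk s, ?_⟩
      change (Submodule.Quotient.mk (a * s) : A ⧸ K) = _
      rw [Submodule.Quotient.eq]
      simpa using ht
    · rintro ⟨s, hs⟩
      obtain ⟨s, rfl⟩ := Submodule.mkQ_surjective L s
      change (Submodule.Quotient.mk (a * s) : A ⧸ K) = Submodule.Quotient.mk r at hs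
      rw [Submodule.Quotient.eq] at hs
      refine ⟨r - a * s, ?_, s, by ring⟩
      rw [← neg_mem_iff]
      simpa using hs

lemma length_quotient_sup_eq {X U J : Ideal A} (hXU : X ≤ U) (h : U ⊓ (X ⊔ J) ≤ X) :
    Module.length A (A ⧸ (X ⊔ J)) =
      Module.length A (U ⧸ Submodule.comap U.subtype X) + Module.length A (A ⧸ (U ⊔ J)) := by
  refine Module.length_eq_add_of_exact
    (Submodule.mapQ (Submodule.comap U.subtype X) (X ⊔ J) U.subtype
      (Submodule.comap_mono le_sup_left))
    (Submodule.mapQ (X ⊔ J) (U ⊔ J) LinearMap.id (sup_le_sup_right hXU J)) ?_ ?_ ?_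
  · rw [← LinearMap.ker_eq_bot, LinearMap.ker_eq_bot']
    intro y hy
    obtain ⟨r, rfl⟩ := Submodule.mkQ_surjective _ y
    simp only [Submodule.mkQ_apply, Submodule.mapQ_apply, Submodule.Quotient.mk_eq_zero] at hy ⊢
    exact h ⟨r.2, hy⟩
  · intro y
    obtain ⟨r, rfl⟩ := Submodule.mkQ_surjective _ y
    exact ⟨Submodule.Quotient.mk r, rfl⟩
  · intro y
    obtain ⟨r, rfl⟩ := Submodule.mkQ_surjective _ y
    simp only [Submodule.mkQ_apply, Submodule.mapQ_apply, Submodule.Quotient.mk_eq_zero,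
      LinearMap.id_apply]
    constructor
    · intro hr
      obtain ⟨u, hu, j, hj, rfl⟩ := Submodule.mem_sup.mp hr
      refine ⟨Submodule.Quotient.mk ⟨u, hu⟩, ?_⟩
      rw [Submodule.mapQ_apply, Submodule.Quotient.eq]
      simpa using (Submodule.mem_sup_right hj : j ∈ X ⊔ J)
    · rintro ⟨s, hs⟩
      obtain ⟨s, rfl⟩ := Submodule.mkQ_surjective _ s
      rw [Submodule.mkQ_apply, Submodule.mapQ_apply, Submodule.Quotient.eq] at hs
      have h1 : (s : A) - r ∈ U ⊔ J := sup_le_sup_right hXU J hs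
      have h2 := sub_mem ((Submodule.mem_sup_left s.2 : (s : A) ∈ U ⊔ J)) h1
      simpa using h2

/-- The length of `A ⧸ K` as a natural number. -/
def colength (K : Ideal A) : ℕ := (Module.length A (A ⧸ K)).toNat

lemma length_quotient_ne_top_of_pow_le [IsLocalRing A] [IsNoetherianRing A] {K : Ideal A} {n : ℕ}
    (h : maximalIdeal A ^ n ≤ K) : Module.length A (A ⧸ K) ≠ ⊤ := by
  rw [Module.length_eq_of_surjective (R := A ⧸ K) Ideal.Quotient.mk_surjective]
  rcases subsingleton_or_nontrivial (A ⧸ K) with hs | hs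
  · rw [Module.length_eq_zero]
    simp
  have := IsLocalRing.of_surjective' (Ideal.Quotient.mk K) Ideal.Quotient.mk_surjective
  have : IsArtinianRing (A ⧸ K) := by
    rw [isArtinianRing_iff_isNilpotent_maximalIdeal]
    refine ⟨n, ?_⟩
    rw [← IsLocalRing.map_maximalIdeal_of_surjective (Ideal.Quotient.mk K)
      Ideal.Quotient.mk_surjective, ← Ideal.map_pow, Ideal.zero_eq_bot, eq_bot_iff,
      ← Ideal.map_quotient_self K]
    exact Ideal.map_mono h
  exact Module.length_ne_top

lemma coe_colength [IsLocalRing A] [IsNoetherianRing A] {K : Ideal A} {n : ℕ}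
    (h : maximalIdeal A ^ n ≤ K) : (colength K : ℕ∞) = Module.length A (A ⧸ K) :=
  ENat.natCast_toNat (length_quotient_ne_top_of_pow_le h)

namespace IsTower

variable {x : ℕ → A} {U : ℕ → Ideal A} {d : ℕ} (h : IsTower x U d)
include h

lemma mul_mem_sup_iff {q J : Ideal A} (hq : q = partialIdeal x d)
    (hJ : ∀ i ≤ d, partialIdeal x i ⊓ q * J ≤ partialIdeal x i * J) {j : ℕ} (hj : j < d) (r : A) :
    x j * r ∈ partialIdeal x j ⊔ q * J ↔ r ∈ U j ⊔ J := by
  constructor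
  · intro hr
    obtain ⟨a, ha, b, hb, hab⟩ := Submodule.mem_sup.mp hr
    have hb' : b ∈ partialIdeal x (j + 1) := by
      have h1 := sub_mem (Ideal.mul_mem_right r _ (mem_partialIdeal x (Nat.lt_succ_self j)))
        (partialIdeal_mono x (Nat.le_succ j) ha)
      rwa [← hab, add_sub_cancel_left] at h1
    obtain ⟨t, ht, s, hs, rfl⟩ := mem_partialIdeal_succ_mul.mp (hJ (j + 1) hj ⟨hb', hb⟩)
    have h1 : x j * (r - s) ∈ U j := by
      rw [show x j * (r - s) = a + t by linear_combination -hab]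
      exact h.le j hj (add_mem ha (Ideal.mul_le_left ht))
    exact Submodule.mem_sup.mpr ⟨r - s, h.cancel j hj _ h1, s, hs, by ring⟩
  · intro hr
    obtain ⟨u, hu, s, hs, rfl⟩ := Submodule.mem_sup.mp hr
    rw [mul_add]
    exact add_mem (Submodule.mem_sup_left (h.kill j hj u hu)) (Submodule.mem_sup_right
      (Ideal.mul_mem_mul (hq ▸ mem_partialIdeal x hj) hs))

lemma length_sup_mul {q J : Ideal A} (hq : q = partialIdeal x d)
    (hJ : ∀ i ≤ d, partialIdeal x i ⊓ q * J ≤ partialIdeal x i * J) {j : ℕ} (hj : j < d) :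
    Module.length A (A ⧸ (partialIdeal x j ⊔ q * J)) =
      Module.length A (A ⧸ (U j ⊔ J)) +
        Module.length A (A ⧸ (partialIdeal x (j + 1) ⊔ q * J)) :=
  length_quotient_eq_of_colon (x j) (h.mul_mem_sup_iff hq hJ hj)
    (by rw [partialIdeal_succ, sup_right_comm])

lemma length_sup {q J : Ideal A} (hq : q = partialIdeal x d) (hJq : J ≤ q) {j : ℕ} (hj : j < d) :
    Module.length A (A ⧸ (partialIdeal x j ⊔ J)) =
      Module.length A (U j ⧸ Submodule.comap (U j).subtype (partialIdeal x j)) +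
        Module.length A (A ⧸ (U j ⊔ J)) := by
  refine length_quotient_sup_eq (h.le j hj) ?_
  exact (inf_le_inf_left _ (sup_le (partialIdeal_mono x hj.le) (hq ▸ hJq))).trans
    (h.inf_partialIdeal_le le_rfl)

end IsTower

end Lengths

section HilbertCoefficients

variable {A : Type} [CommRing A]

lemma moduleLength_eq_coe (M : Type) [AddCommGroup M] [Module A M] :
    moduleLength A M = (Module.length A M : WithBot ℕ∞) :=
  (Module.coe_length A M).symm

lemma colength_eq_add [IsLocalRing A] [IsNoetherianRing A] {K L : Ideal A} (hKL : K ≤ L) {n : ℕ}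
    (h : maximalIdeal A ^ n ≤ K) :
    (colength K : ℕ∞) = Module.length A (L ⧸ Submodule.comap L.subtype K) + colength L := by
  have := length_quotient_sup_eq (J := K) hKL (by simp)
  rwa [sup_idem, sup_eq_left.mpr hKL, ← coe_colength h, ← coe_colength (h.trans hKL)] at this

lemma isHilbertCoeffs_iff [IsLocalRing A] [IsNoetherianRing A] {I : Ideal A} {k : ℕ}
    (hk : maximalIdeal A ^ k ≤ I) (d : ℕ) (e : ℕ → ℤ) :
    IsHilbertCoeffs A d I e ↔
      ∃ N : ℕ, ∀ n ≥ N, (colength (I ^ (n + 1)) : ℤ) = hilbertValue d e n := by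
  have key : ∀ n : ℕ, moduleLength A (A ⧸ I ^ (n + 1)) =
      (((colength (I ^ (n + 1)) : ℕ) : ℕ∞) : WithBot ℕ∞) := fun n => by
    rw [moduleLength_eq_coe, coe_colength (n := k * (n + 1))]
    rw [pow_mul]
    exact Ideal.pow_right_mono hk _
  refine exists_congr fun N => forall₂_congr fun n _ => ⟨?_, fun h => ⟨_, key n, h⟩⟩
  rintro ⟨L, hL, hL'⟩
  rw [key n] at hL
  have : colength (I ^ (n + 1)) = L := by exact_mod_cast hL
  rw [this]
  exact hL'

lemma indexOfReducibility_eq [IsLocalRing A] [IsNoetherianRing A] {q : Ideal A} {n N : ℕ}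
    (h : maximalIdeal A ^ n ≤ q) (hN : indexOfReducibility A q = (N : ℕ∞)) :
    colength q = N + colength (q.colon (maximalIdeal A : Set A)) := by
  have hle : q ≤ q.colon (maximalIdeal A : Set A) := fun y hy =>
    Submodule.mem_colon.mpr fun z _ => Ideal.mul_mem_right _ _ hy
  have h1 := colength_eq_add hle h
  rw [indexOfReducibility, moduleLength_eq_coe] at hN
  have h2 := WithBot.coe_injective hN
  rw [h2] at h1
  exact_mod_cast h1

namespace IsTower

variable [IsLocalRing A] [IsNoetherianRing A] {x : ℕ → A} {U : ℕ → Ideal A} {d : ℕ}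
  (h : IsTower x U d)
include h

lemma colength_sup_mul {q J : Ideal A} (hq : q = partialIdeal x d)
    (hJ : ∀ i ≤ d, partialIdeal x i ⊓ q * J ≤ partialIdeal x i * J) {n : ℕ}
    (hn : maximalIdeal A ^ n ≤ q * J) {j : ℕ} (hj : j < d) :
    colength (partialIdeal x j ⊔ q * J) =
      colength (U j ⊔ J) + colength (partialIdeal x (j + 1) ⊔ q * J) := by
  have h1 := h.length_sup_mul hq hJ hj
  rw [← coe_colength (hn.trans le_sup_right),
    ← coe_colength ((hn.trans Ideal.mul_le_right).trans le_sup_right),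
    ← coe_colength (hn.trans le_sup_right)] at h1
  exact_mod_cast h1

lemma colength_sup_mul_add {q J : Ideal A} (hq : q = partialIdeal x d)
    (hJ : ∀ i ≤ d, partialIdeal x i ⊓ q * J ≤ partialIdeal x i * J) (hJq : J ≤ q) {n : ℕ}
    (hn : maximalIdeal A ^ n ≤ q * J) {j : ℕ} (hj : j < d) :
    colength (partialIdeal x j ⊔ q * J) +
        (Module.length A (U j ⧸ Submodule.comap (U j).subtype (partialIdeal x j))).toNat =
      colength (partialIdeal x j ⊔ J) + colength (partialIdeal x (j + 1) ⊔ q * J) := by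
  have hn' : maximalIdeal A ^ n ≤ J := hn.trans Ideal.mul_le_right
  have h2 := h.length_sup hq hJq hj
  rw [← coe_colength (hn'.trans le_sup_right), ← coe_colength (hn'.trans le_sup_right)] at h2
  have hfin : Module.length A (U j ⧸ Submodule.comap (U j).subtype (partialIdeal x j)) ≠ ⊤ := by
    intro htop
    rw [htop, top_add] at h2
    exact ENat.natCast_ne_top _ h2
  have h1 := h.colength_sup_mul hq hJ hn hj
  generalize Module.length A (U j ⧸ Submodule.comap (U j).subtype (partialIdeal x j)) = u at *
  lift u to ℕ using hfin
  have h2' : colength (partialIdeal x j ⊔ J) = u + colength (U j ⊔ J) := by exact_mod_cast h2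
  simp only [ENat.toNat_natCast]
  omega

/-- Hilbert coefficients of `q = (x 0, …, x (d - 1))` and of `I = q : 𝔪`, for a tower over `x`. -/
theorem exists_hilbertCoeffs {q I : Ideal A} (hd : 1 ≤ d) (hq : q = partialIdeal x d)
    (hI : ∀ u, u ∈ I ↔ ∀ z ∈ maximalIdeal A, z * u ∈ q)
    (hS : ∀ i < d, ∀ u, (∀ z ∈ maximalIdeal A, z * u ∈ q ⊔ U i) → u ∈ I ⊔ U i)
    (hIM : I ≤ maximalIdeal A) (hM : maximalIdeal A * I ≤ maximalIdeal A * q)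
    {k : ℕ} (hk : maximalIdeal A ^ k ≤ q) :
    ∃ e e' : ℕ → ℤ, IsHilbertCoeffs A d q e ∧ IsHilbertCoeffs A d I e' ∧
      e' 1 - e 1 = (colength (U (d - 1) ⊔ q) : ℤ) - colength (U (d - 1) ⊔ I) := by
  have hqI : q ≤ I := fun y hy => (hI y).mpr fun z _ => Ideal.mul_mem_left _ _ hy
  have hpow : ∀ n, I ^ (n + 1) = q ^ n * I :=
    Ideal.pow_succ_eq_of_mul_self_le hqI (h.mul_self_le hq hI hS hIM hM)
  have hJI : ∀ n, ∀ i ≤ d, partialIdeal x i ⊓ q * I ^ (n + 1) ≤ partialIdeal x i * I ^ (n + 1) := by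
    intro n
    rw [hpow]
    exact h.inf_pow_mul_le hq (h.inf_mul_le hq hI hS) n
  have hJq : ∀ n, ∀ i ≤ d, partialIdeal x i ⊓ q * q ^ (n + 1) ≤ partialIdeal x i * q ^ (n + 1) := by
    intro n
    have := h.inf_pow_mul_le (J := ⊤) hq (by intro i _; simp) (n + 1)
    simpa only [Ideal.mul_top] using this
  have hqq : ∀ n, q * q ^ (n + 1) = q ^ (n + 1 + 1) := fun n => (pow_succ' _ _).symm
  have hqI' : ∀ n, q * I ^ (n + 1) = I ^ (n + 1 + 1) := fun n => by
    rw [hpow, hpow, ← mul_assoc, ← pow_succ']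
  have hkp : ∀ n, maximalIdeal A ^ (k * n) ≤ q ^ n := fun n => by
    rw [pow_mul]; exact Ideal.pow_right_mono hk _
  have hkI : ∀ n, maximalIdeal A ^ (k * n) ≤ I ^ n := fun n =>
    (hkp n).trans (Ideal.pow_right_mono hqI _)
  have hIq : ∀ n ≥ 1, I ^ (n + 1) ≤ q := fun n hn => by
    rw [hpow]
    exact Ideal.mul_le_left.trans (Ideal.pow_le_self (by omega))
  obtain ⟨e, e', he, he', h1⟩ := exists_hilbertValue_pair (d := d)
    (g := fun j n => (colength (partialIdeal x j ⊔ q ^ (n + 1)) : ℤ))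
    (g' := fun j n => (colength (partialIdeal x j ⊔ I ^ (n + 1)) : ℤ))
    (u := fun j =>
      ((Module.length A (U j ⧸ Submodule.comap (U j).subtype (partialIdeal x j))).toNat : ℤ))
    (c := colength q)
    (fun j hj n hn => by
      have := h.colength_sup_mul_add hq (hJq n) (Ideal.pow_le_self (by omega))
        (n := k * (n + 1 + 1)) (by rw [hqq]; exact hkp _) hj
      rw [hqq] at this
      exact_mod_cast this)
    (fun j hj n hn => by
      have := h.colength_sup_mul_add hq (hJI n) (hIq n hn)
        (n := k * (n + 1 + 1)) (by rw [hqI']; exact hkI _) hj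
      rw [hqI'] at this
      exact_mod_cast this)
    (fun n hn => by
      simp only [← hq]
      rw [sup_eq_left.mpr (Ideal.pow_le_self (by omega))])
    (fun n hn => by
      simp only [← hq]
      rw [sup_eq_left.mpr (hIq n hn)]) (d - 1) (by omega)
  have hd1 : d - 1 + 1 = d := by omega
  simp only [hd1, Nat.sub_self, partialIdeal_zero, bot_sup_eq] at he he'
  refine ⟨e, e', (isHilbertCoeffs_iff hk d e).mpr ⟨1, he⟩,
    (isHilbertCoeffs_iff (hk.trans hqI) d e').mpr ⟨1, he'⟩, ?_⟩
  have h2 := h.colength_sup_mul hq (hJq 0) (n := k * (0 + 1 + 1)) (by rw [hqq]; exact hkp _)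
    (j := d - 1) (by omega)
  have h3 := h.colength_sup_mul hq (hJI 0) (n := k * (0 + 1 + 1)) (by rw [hqI']; exact hkI _)
    (j := d - 1) (by omega)
  rw [hqq] at h2
  rw [hqI'] at h3
  rw [hd1, ← hq, zero_add, pow_one, sup_eq_left (a := q).mpr (Ideal.pow_le_self (n := 1 + 1) (by omega))] at h2
  rw [hd1, ← hq, zero_add, pow_one, sup_eq_left.mpr (hIq 1 le_rfl)] at h3
  rw [h1, h2, h3]
  push_cast
  ring

end IsTower

end HilbertCoefficients

section Saturation

variable {A : Type} [CommRing A] [IsLocalRing A]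

lemma exists_mem_maximalIdeal_forall_smul_eq_zero [IsNoetherianRing A] (M : Type) [AddCommGroup M]
    [Module A M] [Module.Finite A M]
    (h : ∀ v : M, (∀ z ∈ maximalIdeal A, z • v = 0) → v = 0) :
    ∃ y ∈ maximalIdeal A, ∀ v : M, y • v = 0 → v = 0 := by
  by_contra! hcon
  have hsub : (maximalIdeal A : Set A) ⊆ ⋃ p ∈ associatedPrimes A M, (id p : Ideal A) := by
    intro y hy
    obtain ⟨v, hv, hv0⟩ := hcon y hy
    have : y ∈ ⋃ p ∈ associatedPrimes A M, (p : Set A) := by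
      rw [biUnion_associatedPrimes_eq_zero_divisors]
      exact ⟨v, hv0, hv⟩
    simpa using this
  obtain ⟨p, hp, hmp⟩ := (Ideal.subset_union_prime_finite (associatedPrimes.finite A M) ⊥ ⊥
    fun p hp _ _ => IsAssociatedPrime.isPrime hp).mp hsub
  obtain ⟨hp1, v, rfl⟩ := isAssociatedPrime_iff.mp hp
  have hv := h v fun z hz => by simpa [Submodule.mem_colon_singleton] using hmp hz
  exact hp1.ne_top (by simp [hv])

/-- The saturation `⋃ n, K : 𝔪 ^ n` of the ideal `K`. -/
def saturation (K : Ideal A) : Ideal A where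
  carrier := {r | ∃ n : ℕ, ∀ z ∈ maximalIdeal A ^ n, z * r ∈ K}
  add_mem' := by
    rintro a b ⟨n, hn⟩ ⟨m, hm⟩
    refine ⟨max n m, fun z hz => ?_⟩
    rw [mul_add]
    exact add_mem (hn z (Ideal.pow_le_pow_right (le_max_left _ _) hz))
      (hm z (Ideal.pow_le_pow_right (le_max_right _ _) hz))
  zero_mem' := ⟨0, by simp⟩
  smul_mem' := by
    rintro c r ⟨n, hn⟩
    refine ⟨n, fun z hz => ?_⟩
    rw [smul_eq_mul, mul_left_comm]
    exact Ideal.mul_mem_left _ _ (hn z hz)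

lemma le_saturation (K : Ideal A) : K ≤ saturation K :=
  fun _ hr => ⟨0, fun _ _ => Ideal.mul_mem_left _ _ hr⟩

lemma saturation_mono {K L : Ideal A} (h : K ≤ L) : saturation K ≤ saturation L :=
  fun _ ⟨n, hn⟩ => ⟨n, fun z hz => h (hn z hz)⟩

lemma exists_pow_mul_saturation_le [IsNoetherianRing A] (K : Ideal A) :
    ∃ n, maximalIdeal A ^ n * saturation K ≤ K := by
  suffices ∀ L : Ideal A, L.FG → L ≤ saturation K → ∃ n, maximalIdeal A ^ n * L ≤ K from
    this _ (IsNoetherian.noetherian _) le_rfl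
  intro L hL
  induction L, hL using Submodule.fg_induction with
  | singleton r =>
    intro hr
    obtain ⟨n, hn⟩ := hr (Submodule.mem_span_singleton_self r)
    refine ⟨n, Ideal.mul_le.mpr fun z hz s hs => ?_⟩
    obtain ⟨c, rfl⟩ := Submodule.mem_span_singleton.mp hs
    rw [smul_eq_mul, mul_left_comm]
    exact Ideal.mul_mem_left _ _ (hn z hz)
  | sup L₁ L₂ _ _ h₁ h₂ =>
    intro hL
    obtain ⟨n, hn⟩ := h₁ (le_sup_left.trans hL)
    obtain ⟨m, hm⟩ := h₂ (le_sup_right.trans hL)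
    refine ⟨max n m, ?_⟩
    rw [Ideal.mul_sup]
    exact sup_le ((Ideal.mul_mono_left (Ideal.pow_le_pow_right (le_max_left _ _))).trans hn)
      ((Ideal.mul_mono_left (Ideal.pow_le_pow_right (le_max_right _ _))).trans hm)

lemma mem_saturation_of_forall_mul_mem [IsNoetherianRing A] {K : Ideal A} {r : A}
    (h : ∀ z ∈ maximalIdeal A, z * r ∈ saturation K) : r ∈ saturation K := by
  obtain ⟨n, hn⟩ := exists_pow_mul_saturation_le K
  refine ⟨n + 1, fun z hz => ?_⟩
  have hle : (maximalIdeal A ^ (n + 1)) * Ideal.span {r} ≤ K := by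
    rw [pow_succ, mul_assoc]
    refine (Ideal.mul_mono_right ?_).trans hn
    refine Ideal.mul_le.mpr fun z hz s hs => ?_
    obtain ⟨c, rfl⟩ := Ideal.mem_span_singleton'.mp hs
    rw [mul_left_comm]
    exact Ideal.mul_mem_left _ _ (h z hz)
  exact hle (Ideal.mul_mem_mul hz (Ideal.mem_span_singleton_self r))

lemma exists_cancel_saturation [IsNoetherianRing A] (K : Ideal A) :
    ∃ y ∈ maximalIdeal A, (∀ r, y * r ∈ saturation K → r ∈ saturation K) ∧
      ∀ u ∈ saturation K, y * u ∈ K := by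
  obtain ⟨n, hn⟩ := exists_pow_mul_saturation_le K
  obtain ⟨y, hy, hy'⟩ := exists_mem_maximalIdeal_forall_smul_eq_zero (A ⧸ saturation K) (by
    intro v
    obtain ⟨r, rfl⟩ := Submodule.mkQ_surjective _ v
    intro h
    rw [Submodule.mkQ_apply, Submodule.Quotient.mk_eq_zero]
    refine mem_saturation_of_forall_mul_mem fun z hz => ?_
    have := h z hz
    rwa [← map_smul, Submodule.mkQ_apply, Submodule.Quotient.mk_eq_zero] at this)
  have hyc : ∀ r, y * r ∈ saturation K → r ∈ saturation K := fun r hr => by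
    have := hy' (Submodule.mkQ _ r) (by
      rw [← map_smul, Submodule.mkQ_apply, Submodule.Quotient.mk_eq_zero]; exact hr)
    rwa [Submodule.mkQ_apply, Submodule.Quotient.mk_eq_zero] at this
  refine ⟨y ^ (n + 1), Ideal.pow_mem_of_mem _ hy _ (by omega), ?_, fun u hu => ?_⟩
  · intro r
    generalize n + 1 = k
    induction k with
    | zero => simp
    | succ k ih => exact fun h => ih (hyc _ (by rwa [← mul_assoc, ← pow_succ']))
  · rw [pow_succ', mul_assoc]
    exact Ideal.mul_mem_left _ _ (hn (Ideal.mul_mem_mul (Ideal.pow_mem_pow hy n) hu))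

/-- There is a sequence `y` in `𝔪` such that each `y j` is a nonzerodivisor modulo the saturation of
`(y 0 ^ 3, …, y (j - 1) ^ 3)` and maps this saturation into the ideal. -/
lemma exists_cube_seq (A : Type) [CommRing A] [IsLocalRing A] [IsNoetherianRing A] :
    ∃ y : ℕ → A, ∀ j, y j ∈ maximalIdeal A ∧
      (∀ r, y j * r ∈ saturation (partialIdeal (fun i => y i ^ 3) j) →
        r ∈ saturation (partialIdeal (fun i => y i ^ 3) j)) ∧
      ∀ u ∈ saturation (partialIdeal (fun i => y i ^ 3) j),
        y j * u ∈ partialIdeal (fun i => y i ^ 3) j := by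
  choose c hc hc' hc'' using exists_cancel_saturation (A := A)
  let K : ℕ → Ideal A := fun j => Nat.rec ⊥ (fun _ L => L ⊔ Ideal.span {c L ^ 3}) j
  have hK : ∀ j, partialIdeal (fun i => c (K i) ^ 3) j = K j := by
    intro j
    induction j with
    | zero => exact partialIdeal_zero _
    | succ j ih => rw [partialIdeal_succ, ih]
  refine ⟨fun i => c (K i), fun j => ?_⟩
  rw [hK]
  exact ⟨hc _, hc' _, hc'' _⟩

end Saturation

section Dimension

variable {A : Type} [CommRing A] [IsLocalRing A] [IsNoetherianRing A]

lemma ringKrullDim_le_card_of_pow_le {s : Finset A} (hs : ∀ a ∈ s, a ∈ maximalIdeal A) {n : ℕ}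
    (hn : maximalIdeal A ^ n ≤ Ideal.span s) : ringKrullDim A ≤ s.card := by
  rw [← IsLocalRing.maximalIdeal_height_eq_ringKrullDim]
  have : (maximalIdeal A).height ≤ s.card := by
    refine Ideal.height_le_card_of_mem_minimalPrimes_span_finset ⟨⟨inferInstance, ?_⟩, ?_⟩
    · exact Ideal.span_le.mpr fun a ha => hs a ha
    · rintro p ⟨hp, hp'⟩ -
      exact hp.le_of_pow_le (hn.trans hp')
  exact_mod_cast this

lemma le_of_pow_le_partialIdeal {d : ℕ} (hdim : ringKrullDim A = d) {x : ℕ → A}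
    (hx : ∀ i, x i ∈ maximalIdeal A) {j n : ℕ}
    (hn : maximalIdeal A ^ n ≤ partialIdeal x j) : d ≤ j := by
  classical
  rw [partialIdeal_eq_span_finset] at hn
  have := ringKrullDim_le_card_of_pow_le (s := (Finset.range j).image x)
    (by simpa using fun i _ => hx i) hn
  rw [hdim] at this
  have h1 : d ≤ ((Finset.range j).image x).card := by exact_mod_cast this
  exact h1.trans (Finset.card_image_le.trans (by simp))

lemma le_of_pow_le_partialIdeal_sup {d : ℕ} (hdim : ringKrullDim A = d) {x : ℕ → A}
    (hx : ∀ i, x i ∈ maximalIdeal A) {z : A} (hz : z ∈ maximalIdeal A) {j n : ℕ}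
    (hn : maximalIdeal A ^ n ≤ partialIdeal x j ⊔ Ideal.span {z}) : d ≤ j + 1 := by
  let x' : ℕ → A := fun i => if i < j then x i else z
  have h1 : partialIdeal x' j = partialIdeal x j := by
    rw [partialIdeal, partialIdeal]
    congr 1
    exact Set.image_congr fun i hi => by simp [x', Set.mem_Iio.mp hi]
  refine le_of_pow_le_partialIdeal hdim (x := x') (n := n) (fun i => ?_) ?_
  · simp only [x']
    split_ifs
    · exact hx i
    · exact hz
  · rw [partialIdeal_succ, h1]
    simpa [x'] using hn

lemma exists_pow_le_of_cancel {d : ℕ} (hdim : ringKrullDim A = d) {x : ℕ → A} {U : ℕ → Ideal A}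
    (hx : ∀ j, x j ∈ U (j + 1)) (hU : Monotone U)
    (hc : ∀ j, ∀ r, x j * r ∈ U j → r ∈ U j) : ∃ n, maximalIdeal A ^ n ≤ U d := by
  have key : ∀ j : ℕ, ringKrullDim (A ⧸ U j) + j ≤ d := by
    intro j
    induction j with
    | zero =>
      simp only [Nat.cast_zero, add_zero, ← hdim]
      exact ringKrullDim_le_of_surjective _ (Ideal.Quotient.mk_surjective (I := U 0))
    | succ j ih =>
      refine le_trans ?_ ih
      have hreg : Ideal.Quotient.mk (U j) (x j) ∈ nonZeroDivisors (A ⧸ U j) := by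
        rw [mem_nonZeroDivisors_iff_right]
        intro r hr
        obtain ⟨r, rfl⟩ := Ideal.Quotient.mk_surjective r
        rw [← map_mul, Ideal.Quotient.eq_zero_iff_mem] at hr
        rw [Ideal.Quotient.eq_zero_iff_mem]
        exact hc j r (by rwa [mul_comm])
      have h1 := ringKrullDim_quotient_succ_le_of_nonZeroDivisor hreg
      have h2 : ringKrullDim (A ⧸ U (j + 1)) ≤
          ringKrullDim ((A ⧸ U j) ⧸ Ideal.span {Ideal.Quotient.mk (U j) (x j)}) := by
        refine ringKrullDim_le_of_surjective (Ideal.Quotient.lift _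
          (Ideal.Quotient.factor (hU (Nat.le_succ j))) ?_) ?_
        · intro a ha
          obtain ⟨b, rfl⟩ := Ideal.mem_span_singleton'.mp ha
          rw [map_mul, Ideal.Quotient.factor_mk, Ideal.Quotient.eq_zero_iff_mem.mpr (hx j),
            mul_zero]
        · exact Ideal.Quotient.lift_surjective_of_surjective _ _
            (Ideal.Quotient.factor_surjective _)
      push_cast
      rw [add_comm (j : WithBot ℕ∞), ← add_assoc]
      gcongr
      exact (add_le_add_left h2 1).trans h1
  have hd := key d
  have h0 : Ring.KrullDimLE 0 (A ⧸ U d) := by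
    rw [Ring.krullDimLE_iff]
    generalize ringKrullDim (A ⧸ U d) = r at hd
    induction r with
    | bot => exact bot_le
    | coe r =>
      have h1 : r + d ≤ 0 + d := by rw [zero_add]; exact_mod_cast hd
      exact_mod_cast (ENat.add_le_add_iff_right (ENat.natCast_ne_top d)).mp h1
  have := isArtinianRing_iff_krullDimLE_zero.mpr h0
  exact IsLocalRing.exists_maximalIdeal_pow_le_of_isArtinianRing_quotient (U d)

end Dimension

section CubeSequence

variable {A : Type} [CommRing A] [IsLocalRing A]

/-- Each `y j` lies in `𝔪`, is a nonzerodivisor modulo the saturation of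
`(y 0 ^ 3, …, y (j - 1) ^ 3)` and maps this saturation into the ideal. -/
structure IsCubeSeq (y : ℕ → A) : Prop where
  mem : ∀ j, y j ∈ maximalIdeal A
  cancel : ∀ j r, y j * r ∈ saturation (partialIdeal (fun i => y i ^ 3) j) →
    r ∈ saturation (partialIdeal (fun i => y i ^ 3) j)
  kill : ∀ j, ∀ u ∈ saturation (partialIdeal (fun i => y i ^ 3) j),
    y j * u ∈ partialIdeal (fun i => y i ^ 3) j

namespace IsCubeSeq

variable {y : ℕ → A} (hy : IsCubeSeq y)
include hy

lemma pow_cancel {j n : ℕ} {r : A}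
    (h : y j ^ n * r ∈ saturation (partialIdeal (fun i => y i ^ 3) j)) :
    r ∈ saturation (partialIdeal (fun i => y i ^ 3) j) := by
  induction n with
  | zero => simpa using h
  | succ n ih => exact ih (hy.cancel j _ (by rwa [← mul_assoc, ← pow_succ']))

lemma isTower (d : ℕ) : IsTower (fun i => y i ^ 3)
    (fun j => saturation (partialIdeal (fun i => y i ^ 3) j)) d where
  le j _ := le_saturation _
  mono i j hij _ := saturation_mono (partialIdeal_mono _ hij)
  cancel j _ r h := hy.pow_cancel h
  kill j _ u hu := by
    have := Ideal.mul_mem_left _ (y j ^ 2) (hy.kill j u hu)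
    rwa [← mul_assoc, ← pow_succ] at this

lemma exists_eq_sq_mul_add {j : ℕ} {V : Ideal A} (hV : partialIdeal (fun i => y i ^ 3) j ≤ V)
    (hVU : V ≤ saturation (partialIdeal (fun i => y i ^ 3) j)) {u : A}
    (hu : ∀ z ∈ maximalIdeal A, z * u ∈ V ⊔ Ideal.span {y j ^ 3}) :
    ∃ r w, u = y j ^ 2 * r + w ∧ ∀ z ∈ maximalIdeal A, z * w ∈ V ∧
      ∃ s, ∃ v ∈ saturation (partialIdeal (fun i => y i ^ 3) j), z * r = y j * s + v := by
  obtain ⟨a, ha, r, hr⟩ := Ideal.mem_sup_span_singleton_iff.mp (hu _ (hy.mem j))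
  have hw : u - y j ^ 2 * r ∈ saturation (partialIdeal (fun i => y i ^ 3) j) := by
    refine hy.cancel j _ ?_
    rw [show y j * (u - y j ^ 2 * r) = a by linear_combination hr]
    exact hVU ha
  refine ⟨r, u - y j ^ 2 * r, by ring, fun z hz => ?_⟩
  obtain ⟨b, hb, s, hs⟩ := Ideal.mem_sup_span_singleton_iff.mp (hu z hz)
  have hv : z * r - y j * s ∈ saturation (partialIdeal (fun i => y i ^ 3) j) := by
    refine hy.pow_cancel (n := 2) ?_
    rw [show y j ^ 2 * (z * r - y j * s) = b - z * (u - y j ^ 2 * r) by linear_combination hs]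
    exact sub_mem (hVU hb) (Ideal.mul_mem_left _ _ hw)
  refine ⟨?_, s, _, hv, by ring⟩
  rw [show z * (u - y j ^ 2 * r) = b - y j * (y j * (z * r - y j * s)) by linear_combination hs]
  exact sub_mem hb (Ideal.mul_mem_left _ _ (hV (hy.kill j _ hv)))

lemma exists_colon_add [IsNoetherianRing A] {i j : ℕ} (hij : i ≤ j) {u : A}
    (hu : ∀ z ∈ maximalIdeal A, z * u ∈ partialIdeal (fun i => y i ^ 3) j ⊔
      saturation (partialIdeal (fun i => y i ^ 3) i)) :
    ∃ c e, u = c + e ∧ (∀ z ∈ maximalIdeal A, z * c ∈ partialIdeal (fun i => y i ^ 3) j) ∧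
      e ∈ saturation (partialIdeal (fun i => y i ^ 3) i) := by
  induction j, hij using Nat.le_induction generalizing u with
  | base =>
    rw [sup_eq_right.mpr (le_saturation _)] at hu
    exact ⟨0, u, by simp, by simp, mem_saturation_of_forall_mul_mem hu⟩
  | succ j hij ih =>
    rw [partialIdeal_succ, sup_right_comm] at hu
    obtain ⟨r, w, rfl, h⟩ := hy.exists_eq_sq_mul_add le_sup_left
      (sup_le (le_saturation _) (saturation_mono (partialIdeal_mono _ hij))) hu
    obtain ⟨c, e, rfl, hc, he⟩ := ih fun z hz => (h z hz).1
    refine ⟨y j ^ 2 * r + c, e, by ring, fun z hz => ?_, he⟩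
    obtain ⟨-, s, v, hv, hzr⟩ := h z hz
    refine mem_partialIdeal_succ.mpr ⟨y j * (y j * v) + z * c,
      add_mem (Ideal.mul_mem_left _ _ (hy.kill j v hv)) (hc z hz), s, ?_⟩
    linear_combination y j ^ 2 * hzr

variable [IsNoetherianRing A] {d : ℕ}

omit hy in
lemma saturation_not_pow_le (hdim : ringKrullDim A = d) {x : ℕ → A}
    (hx : ∀ i, x i ∈ maximalIdeal A) {j : ℕ} (hj : j < d) {n : ℕ} {z : A}
    (hz : z ∈ maximalIdeal A) (hjz : j + 1 < d ∨ z = 0)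
    (h : maximalIdeal A ^ n ≤ saturation (partialIdeal x j) ⊔ Ideal.span {z}) : False := by
  obtain ⟨N, hN⟩ := exists_pow_mul_saturation_le (partialIdeal x j)
  have h1 : maximalIdeal A ^ (N + n) ≤ partialIdeal x j ⊔ Ideal.span {z} := by
    rw [pow_add]
    refine (Ideal.mul_mono_right h).trans ?_
    rw [Ideal.mul_sup]
    exact sup_le_sup hN Ideal.mul_le_right
  rcases hjz with hjz | rfl
  · exact absurd (le_of_pow_le_partialIdeal_sup hdim hx hz h1) (by omega)
  · rw [Ideal.span_singleton_zero, sup_bot_eq] at h1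
    exact absurd (le_of_pow_le_partialIdeal hdim hx h1) (by omega)

lemma not_maximalIdeal_le (hdim : ringKrullDim A = d) (hd : 2 ≤ d) {j : ℕ} (hj : j < d) {z : A}
    (hz : z ∈ maximalIdeal A)
    (hcz : ∀ t, z * t ∈ saturation (partialIdeal (fun i => y i ^ 3) j) →
      t ∈ saturation (partialIdeal (fun i => y i ^ 3) j))
    (h : maximalIdeal A ≤ saturation (partialIdeal (fun i => y i ^ 3) j) ⊔ Ideal.span {z}) :
    False := by
  have hx : ∀ i, y i ^ 3 ∈ maximalIdeal A := fun i => Ideal.pow_mem_of_mem _ (hy.mem i) _ (by omega)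
  rcases j with _ | i
  · exact saturation_not_pow_le hdim hx hj (n := 1) hz (Or.inl (by omega)) (by simpa using h)
  have hne : ∀ a ∈ saturation (partialIdeal (fun i => y i ^ 3) (i + 1)), ¬ IsUnit a := by
    intro a ha hu
    refine saturation_not_pow_le hdim hx hj (n := 1) (zero_mem _) (Or.inr rfl) ?_
    rw [Ideal.eq_top_of_isUnit_mem _ ha hu]
    simp
  have hcz' : ∀ n t, z ^ n * t ∈ saturation (partialIdeal (fun i => y i ^ 3) (i + 1)) →
      t ∈ saturation (partialIdeal (fun i => y i ^ 3) (i + 1)) := by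
    intro n t
    induction n with
    | zero => simp
    | succ n ih => exact fun h => ih (hcz _ (by rwa [← mul_assoc, ← pow_succ']))
  have hw3 : y i ^ 3 ∈ saturation (partialIdeal (fun i => y i ^ 3) (i + 1)) :=
    le_saturation _ (mem_partialIdeal _ (Nat.lt_succ_self i))
  have hwn : ∀ n : ℕ, ∃ a, y i - z ^ n * a ∈
      saturation (partialIdeal (fun i => y i ^ 3) (i + 1)) := by
    intro n
    induction n with
    | zero => exact ⟨y i, by simp⟩
    | succ n ih =>
      obtain ⟨a, ha⟩ := ih
      have haM : a ∈ maximalIdeal A := by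
        rw [mem_maximalIdeal, mem_nonunits_iff]
        intro hu
        refine hne _ (hcz' (n * 3) (a ^ 3) ?_) (hu.pow 3)
        rw [show z ^ (n * 3) * a ^ 3 = y i ^ 3 - (y i - z ^ n * a) *
          (y i ^ 2 + y i * (z ^ n * a) + (z ^ n * a) ^ 2) by ring]
        exact sub_mem hw3 (Ideal.mul_mem_right _ _ ha)
      obtain ⟨t, ht, b, rfl⟩ := Ideal.mem_sup_span_singleton_iff.mp (h haM)
      refine ⟨b, ?_⟩
      rw [show y i - z ^ (n + 1) * b = (y i - z ^ n * (t + z * b)) + z ^ n * t by ring]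
      exact add_mem ha (Ideal.mul_mem_left _ _ ht)
  have hwU : y i ∈ saturation (partialIdeal (fun i => y i ^ 3) (i + 1)) := by
    have hkrull := Ideal.iInf_pow_smul_eq_bot_of_isLocalRing
      (M := A ⧸ saturation (partialIdeal (fun i => y i ^ 3) (i + 1))) (maximalIdeal A)
      (Ideal.IsPrime.ne_top inferInstance)
    rw [← Submodule.Quotient.mk_eq_zero, ← Submodule.mem_bot A, ← hkrull, Submodule.mem_iInf]
    intro n
    obtain ⟨a, ha⟩ := hwn n
    rw [← Submodule.Quotient.eq] at ha
    rw [ha, ← smul_eq_mul, Submodule.Quotient.mk_smul]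
    exact Submodule.smul_mem_smul (Ideal.pow_mem_pow hz n) trivial
  obtain ⟨n, hn⟩ := hwU
  refine saturation_not_pow_le hdim hx (j := i) (n := n) (by omega) (hy.mem i)
    (Or.inl (by omega)) fun c hc => ?_
  obtain ⟨t, ht, r, hr⟩ := mem_partialIdeal_succ.mp (hn c hc)
  have h1 : c - y i ^ 2 * r ∈ saturation (partialIdeal (fun i => y i ^ 3) i) := by
    refine hy.cancel i _ ?_
    rw [show y i * (c - y i ^ 2 * r) = t by linear_combination hr]
    exact le_saturation _ ht
  exact Ideal.mem_sup_span_singleton_iff.mpr ⟨_, h1, y i * r, by ring⟩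

lemma mul_mem_maximalIdeal_mul (hdim : ringKrullDim A = d) (hd : 2 ≤ d) {j : ℕ} (hj : j ≤ d) {c : A}
    (hc : ∀ z ∈ maximalIdeal A, z * c ∈ partialIdeal (fun i => y i ^ 3) j) :
    ∀ z ∈ maximalIdeal A, z * c ∈ maximalIdeal A * partialIdeal (fun i => y i ^ 3) j := by
  induction j generalizing c with
  | zero => simpa [partialIdeal_zero] using hc
  | succ j ih =>
    rw [partialIdeal_succ] at hc
    obtain ⟨r, w, rfl, h⟩ := hy.exists_eq_sq_mul_add le_rfl (le_saturation _) hc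
    intro z hz
    have hmono := Ideal.mul_mono_right (I := maximalIdeal A)
      (partialIdeal_mono (fun i => y i ^ 3) (Nat.le_succ j))
    have hw := hmono (ih (by omega) (fun z hz => (h z hz).1) z hz)
    obtain ⟨-, s, v, hv, hzr⟩ := h z hz
    have hs : s ∈ maximalIdeal A := by
      rw [mem_maximalIdeal, mem_nonunits_iff]
      intro hu
      have hsc : ∀ t, s * t ∈ saturation (partialIdeal (fun i => y i ^ 3) j) →
          t ∈ saturation (partialIdeal (fun i => y i ^ 3) j) :=
        fun t => (Ideal.unit_mul_mem_iff_mem _ hu).mp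
      have hzc : ∀ t, z * r * t ∈ saturation (partialIdeal (fun i => y i ^ 3) j) →
          t ∈ saturation (partialIdeal (fun i => y i ^ 3) j) := by
        intro t ht
        refine hsc _ (hy.cancel j _ ?_)
        rw [show y j * (s * t) = z * r * t - t * v by linear_combination -t * hzr]
        exact sub_mem ht (Ideal.mul_mem_left _ _ hv)
      refine hy.not_maximalIdeal_le hdim hd (j := j) (by omega) hz (fun t ht => hzc t ?_) ?_
      · rw [mul_right_comm]
        exact Ideal.mul_mem_right _ _ ht
      · intro z' hz'
        obtain ⟨-, s', v', hv', hzr'⟩ := h z' hz'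
        have h1 : s * z' - z * s' ∈ saturation (partialIdeal (fun i => y i ^ 3) j) := by
          refine hzc _ ?_
          rw [show z * r * (s * z' - z * s') = z * (s * v' - s' * v) by
            linear_combination z * s * hzr' - z * s' * hzr]
          exact Ideal.mul_mem_left _ _
            (sub_mem (Ideal.mul_mem_left _ _ hv') (Ideal.mul_mem_left _ _ hv))
        refine (Ideal.unit_mul_mem_iff_mem _ hu).mp ?_
        exact Ideal.mem_sup_span_singleton_iff.mpr ⟨_, h1, s', by ring⟩
    rw [show z * (y j ^ 2 * r + w) = s * y j ^ 3 + y j * (y j * v) + z * w by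
      linear_combination y j ^ 2 * hzr]
    refine add_mem (add_mem ?_ ?_) hw
    · exact Ideal.mul_mem_mul hs (mem_partialIdeal _ (Nat.lt_succ_self j))
    · exact hmono (Ideal.mul_mem_mul (hy.mem j) (hy.kill j v hv))

lemma exists_pow_le (hdim : ringKrullDim A = d) :
    ∃ n, maximalIdeal A ^ n ≤ partialIdeal (fun i => y i ^ 3) d := by
  obtain ⟨n, hn⟩ := exists_pow_le_of_cancel hdim (x := fun i => y i ^ 3)
    (U := fun j => saturation (partialIdeal (fun i => y i ^ 3) j))
    (fun j => le_saturation _ (mem_partialIdeal _ (Nat.lt_succ_self j)))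
    (fun i j hij => saturation_mono (partialIdeal_mono _ hij)) (fun j r h => hy.pow_cancel h)
  obtain ⟨N, hN⟩ := exists_pow_mul_saturation_le (partialIdeal (fun i => y i ^ 3) d)
  exact ⟨N + n, by rw [pow_add]; exact (Ideal.mul_mono_right hn).trans hN⟩

end IsCubeSeq

end CubeSequence

section Colon

variable {A : Type} [CommRing A] [IsLocalRing A]

lemma mem_colon_maximalIdeal {q : Ideal A} {u : A} :
    u ∈ q.colon (maximalIdeal A : Set A) ↔ ∀ z ∈ maximalIdeal A, z * u ∈ q := by
  simp only [Submodule.mem_colon, SetLike.mem_coe, smul_eq_mul, mul_comm u]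

lemma le_colon_maximalIdeal (q : Ideal A) : q ≤ q.colon (maximalIdeal A : Set A) := fun _ hy =>
  mem_colon_maximalIdeal.mpr fun _ _ => Ideal.mul_mem_left _ _ hy

variable [IsNoetherianRing A]

lemma exists_indexOfReducibility_eq {q : Ideal A} {n : ℕ} (h : maximalIdeal A ^ n ≤ q) :
    ∃ N : ℕ, indexOfReducibility A q = (N : ℕ∞) := by
  have h1 := colength_eq_add (le_colon_maximalIdeal q) h
  have hfin : Module.length A (q.colon (maximalIdeal A : Set A) ⧸
      Submodule.comap (q.colon (maximalIdeal A : Set A)).subtype q) ≠ ⊤ := by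
    intro htop
    rw [htop, top_add] at h1
    exact ENat.natCast_ne_top _ h1
  obtain ⟨N, hN⟩ := ENat.ne_top_iff_exists.mp hfin
  exact ⟨N, by rw [indexOfReducibility, moduleLength_eq_coe, hN]⟩

lemma inf_le_of_colength_le {q I U : Ideal A} (hqI : q ≤ I) {n : ℕ} (h : maximalIdeal A ^ n ≤ q)
    (hle : colength q + colength (U ⊔ I) ≤ colength (U ⊔ q) + colength I) : I ⊓ U ≤ q := by
  have hq' : q ≤ I ⊓ (U ⊔ q) := le_inf hqI le_sup_right
  have h1 := colength_eq_add hq' h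
  have h2 := colength_eq_add (K := I ⊓ (U ⊔ q)) inf_le_left (h.trans hq')
  have h3 := length_quotient_sup_eq (X := I ⊓ (U ⊔ q)) (U := I) (J := U ⊔ q) inf_le_left
    (inf_le_inf_left _ (sup_le inf_le_right le_rfl))
  rw [sup_eq_right.mpr inf_le_right, sup_left_comm, sup_eq_left.mpr hqI,
    ← coe_colength (h.trans le_sup_right),
    ← coe_colength ((h.trans hqI).trans le_sup_right)] at h3
  have hfin : Module.length A (I ⧸ Submodule.comap I.subtype (I ⊓ (U ⊔ q))) ≠ ⊤ := by
    intro htop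
    rw [htop, top_add] at h2
    exact ENat.natCast_ne_top _ h2
  generalize Module.length A (I ⧸ Submodule.comap I.subtype (I ⊓ (U ⊔ q))) = v at *
  lift v to ℕ using hfin
  have h2' : colength (I ⊓ (U ⊔ q)) = v + colength I := by exact_mod_cast h2
  have h3' : colength (U ⊔ q) = v + colength (U ⊔ I) := by exact_mod_cast h3
  have hzero : Module.length A
      (↥(I ⊓ (U ⊔ q)) ⧸ Submodule.comap (I ⊓ (U ⊔ q)).subtype q) = 0 := by
    generalize Module.length A
      (↥(I ⊓ (U ⊔ q)) ⧸ Submodule.comap (I ⊓ (U ⊔ q)).subtype q) = w at *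
    have hw : w ≠ ⊤ := by
      rintro rfl
      rw [top_add] at h1
      exact ENat.natCast_ne_top _ h1
    lift w to ℕ using hw
    have h1' : colength q = w + colength (I ⊓ (U ⊔ q)) := by exact_mod_cast h1
    have : w = 0 := by omega
    exact_mod_cast this
  rw [Module.length_eq_zero_iff, Submodule.Quotient.subsingleton_iff,
    Submodule.comap_subtype_eq_top] at hzero
  exact (inf_le_inf_left _ le_sup_left).trans hzero

lemma colon_maximalIdeal_le {d : ℕ} (hdim : ringKrullDim A = d) (hd : 1 ≤ d) {q : Ideal A}
    (hq : q ≤ maximalIdeal A ^ 2) : q.colon (maximalIdeal A : Set A) ≤ maximalIdeal A := by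
  refine le_maximalIdeal fun htop => ?_
  have h1 : maximalIdeal A ≤ q := fun z hz => by
    have := mem_colon_maximalIdeal.mp (htop ▸ Submodule.mem_top : (1 : A) ∈ _) z hz
    rwa [mul_one] at this
  have h2 : maximalIdeal A ≤ maximalIdeal A • maximalIdeal A := by
    rw [smul_eq_mul, ← sq]
    exact h1.trans hq
  have h3 := Submodule.eq_bot_of_le_smul_of_le_jacobson_bot (maximalIdeal A) (maximalIdeal A)
    (IsNoetherian.noetherian _) h2 (IsLocalRing.maximalIdeal_le_jacobson _)
  have := le_of_pow_le_partialIdeal hdim (x := fun _ => 0) (fun _ => zero_mem _) (j := 0) (n := 1)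
    (by rw [pow_one, h3]; exact bot_le)
  omega

omit [IsNoetherianRing A] in
lemma isParameterIdeal_partialIdeal {x : ℕ → A} (hx : ∀ i, x i ∈ maximalIdeal A) {d n : ℕ}
    (hn : maximalIdeal A ^ n ≤ partialIdeal x d) : IsParameterIdeal A d (partialIdeal x d) := by
  refine ⟨⟨fun i => x i, ?_⟩, le_antisymm ?_ fun z hz => ⟨n, hn (Ideal.pow_mem_pow hz n)⟩⟩
  · rw [partialIdeal]
    congr 1
    ext a
    constructor
    · rintro ⟨i, hi, rfl⟩
      exact ⟨⟨i, hi⟩, rfl⟩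
    · rintro ⟨i, rfl⟩
      exact ⟨i, i.2, rfl⟩
  · refine (Ideal.IsPrime.radical_le_iff inferInstance).mpr (Ideal.span_le.mpr ?_)
    rintro _ ⟨i, -, rfl⟩
    exact hx i

/-- If `𝒩(q) ≤ e₁(q : 𝔪) - e₁(q)` for all parameter ideals `q ⊆ 𝔪²`, then some system of
parameters is a regular sequence. -/
theorem exists_regular_of_indexOfReducibility_le {d : ℕ} (hdim : ringKrullDim A = d) (hd : 2 ≤ d)
    (H : ∀ q : Ideal A, IsParameterIdeal A d q → q ≤ maximalIdeal A ^ 2 →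
        ∀ eI eQ : ℕ → ℤ, IsHilbertCoeffs A d (q.colon (maximalIdeal A)) eI →
          IsHilbertCoeffs A d q eQ →
          ∀ Nq : ℕ, indexOfReducibility A q = (Nq : ℕ∞) → (Nq : ℤ) ≤ eI 1 - eQ 1) :
    ∃ (x : ℕ → A) (n : ℕ), (∀ i, x i ∈ maximalIdeal A) ∧
      (∀ j < d, ∀ r, x j * r ∈ partialIdeal x j → r ∈ partialIdeal x j) ∧
      maximalIdeal A ^ n ≤ partialIdeal x d := by
  obtain ⟨y, hy'⟩ := exists_cube_seq A
  have hy : IsCubeSeq y := ⟨fun j => (hy' j).1, fun j => (hy' j).2.1, fun j => (hy' j).2.2⟩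
  have hx : ∀ i, y i ^ 3 ∈ maximalIdeal A := fun i => Ideal.pow_mem_of_mem _ (hy.mem i) _ (by omega)
  have hT := hy.isTower d
  obtain ⟨n, hn⟩ := hy.exists_pow_le hdim
  set q := partialIdeal (fun i => y i ^ 3) d with hq
  have hq2 : q ≤ maximalIdeal A ^ 2 := by
    refine Ideal.span_le.mpr ?_
    rintro _ ⟨i, -, rfl⟩
    exact Ideal.pow_le_pow_right (show 2 ≤ 3 by omega) (Ideal.pow_mem_pow (hy.mem i) 3)
  obtain ⟨e, e', he, he', h1⟩ := hT.exists_hilbertCoeffs (by omega) hq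
    (fun u => mem_colon_maximalIdeal (q := q)) (fun i hi u hu => by
      obtain ⟨c, e, rfl, hc, he⟩ := hy.exists_colon_add hi.le hu
      exact Submodule.mem_sup.mpr ⟨c, mem_colon_maximalIdeal.mpr hc, e, he, rfl⟩)
    (colon_maximalIdeal_le hdim (by omega) hq2)
    (Ideal.mul_le.mpr fun z hz c hc =>
      hy.mul_mem_maximalIdeal_mul hdim hd le_rfl (mem_colon_maximalIdeal.mp hc) z hz) hn
  obtain ⟨N, hN⟩ := exists_indexOfReducibility_eq hn
  have h2 := H q (isParameterIdeal_partialIdeal hx hn) hq2 e' e he' he N hN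
  have h3 := indexOfReducibility_eq hn hN
  have hinf := inf_le_of_colength_le (le_colon_maximalIdeal q) hn
    (U := saturation (partialIdeal (fun i => y i ^ 3) (d - 1))) (by omega)
  have hlast : saturation (partialIdeal (fun i => y i ^ 3) (d - 1)) ≤
      partialIdeal (fun i => y i ^ 3) (d - 1) := by
    obtain ⟨m, hm⟩ := exists_pow_mul_saturation_le (partialIdeal (fun i => y i ^ 3) (d - 1))
    suffices ∀ m, maximalIdeal A ^ m * saturation (partialIdeal (fun i => y i ^ 3) (d - 1)) ≤
        partialIdeal (fun i => y i ^ 3) (d - 1) →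
        saturation (partialIdeal (fun i => y i ^ 3) (d - 1)) ≤
        partialIdeal (fun i => y i ^ 3) (d - 1) from this m hm
    intro m
    induction m with
    | zero => simp
    | succ m ih =>
      refine fun h => ih fun s hs => ?_
      have hsU := Ideal.mul_le_right hs
      refine hT.inf_partialIdeal_le le_rfl ⟨hsU, hinf ⟨mem_colon_maximalIdeal.mpr fun z hz => ?_, hsU⟩⟩
      refine partialIdeal_mono _ (Nat.sub_le d 1) (h ?_)
      rw [pow_succ', mul_assoc]
      exact Ideal.mul_mem_mul hz hs
  have hall : ∀ j < d, saturation (partialIdeal (fun i => y i ^ 3) j) ≤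
      partialIdeal (fun i => y i ^ 3) j := fun j hj s hs =>
    hT.inf_partialIdeal_le (Nat.sub_le d 1)
      ⟨hs, hlast (saturation_mono (partialIdeal_mono _ (Nat.le_sub_one_of_lt hj)) hs)⟩
  exact ⟨_, n, hx, fun j hj r hr => hall j hj (hT.cancel j hj r (le_saturation _ hr)), hn⟩

end Colon

section CochainExact

variable {A : Type} [CommRing A]

/-- Exactness of `Hom(P₀, M) → Hom(P₁, M) → Hom(P₂, M)`. -/
def CochainExact {P₂ P₁ P₀ : Type} [AddCommGroup P₂] [Module A P₂] [AddCommGroup P₁] [Module A P₁]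
    [AddCommGroup P₀] [Module A P₀] (f : P₂ →ₗ[A] P₁) (g : P₁ →ₗ[A] P₀)
    (M : Type) [AddCommGroup M] [Module A M] : Prop :=
  ∀ φ : P₁ →ₗ[A] M, φ ∘ₗ f = 0 → ∃ ψ : P₀ →ₗ[A] M, φ = ψ ∘ₗ g

variable {P₃ P₂ P₁ P₀ : Type} [AddCommGroup P₃] [Module A P₃] [AddCommGroup P₂] [Module A P₂]
  [AddCommGroup P₁] [Module A P₁] [AddCommGroup P₀] [Module A P₀]
  {f : P₃ →ₗ[A] P₂} {g : P₂ →ₗ[A] P₁} {h : P₁ →ₗ[A] P₀}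
  {M N : Type} [AddCommGroup M] [Module A M] [AddCommGroup N] [Module A N]

lemma CochainExact.of_linearEquiv (e : M ≃ₗ[A] N) (H : CochainExact f g M) :
    CochainExact f g N := by
  intro φ hφ
  obtain ⟨ψ, hψ⟩ := H (e.symm ∘ₗ φ) (by rw [LinearMap.comp_assoc, hφ, LinearMap.comp_zero])
  refine ⟨e ∘ₗ ψ, ?_⟩
  rw [LinearMap.comp_assoc, ← hψ]
  ext
  simp

variable {x : A} (hx : ∀ v : M, x • v = 0 → v = 0) {π : M →ₗ[A] N}
  (hπ : ∀ v, π v = 0 ↔ ∃ w, v = x • w)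

include hx hπ in
lemma exists_eq_smul_of_comp_eq_zero {P : Type} [AddCommGroup P] [Module A P] (φ : P →ₗ[A] M)
    (h : π ∘ₗ φ = 0) : ∃ ρ : P →ₗ[A] M, φ = x • ρ := by
  have hv : ∀ v, ∃ w, φ v = x • w := fun v => (hπ _).mp (LinearMap.congr_fun h v)
  choose ρ hρ using hv
  have hinj : ∀ a b : M, x • a = x • b → a = b := fun a b hab =>
    sub_eq_zero.mp (hx _ (by rw [smul_sub, hab, sub_self]))
  refine ⟨⟨⟨ρ, fun a b => hinj _ _ ?_⟩, fun r a => hinj _ _ ?_⟩, ?_⟩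
  · rw [← hρ, smul_add, ← hρ, ← hρ, map_add]
  · rw [← hρ, RingHom.id_apply, smul_comm, ← hρ, map_smul]
  · ext a
    exact hρ a

include hx hπ in
lemma CochainExact.of_quotient [Module.Projective A P₀] (hsurj : Function.Surjective π)
    (hgh : h ∘ₗ g = 0)
    (hom : ∀ φ : P₂ →ₗ[A] M, φ ∘ₗ f = 0 → ∃ ψ : P₁ →ₗ[A] M, x • φ = ψ ∘ₗ g)
    (H : CochainExact g h N) : CochainExact f g M := by
  intro φ hφ
  obtain ⟨ψ, hψ⟩ := hom φ hφ
  obtain ⟨θ', hθ'⟩ := H (π ∘ₗ ψ) (by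
    rw [LinearMap.comp_assoc, ← hψ]
    ext a
    exact (hπ _).mpr ⟨_, rfl⟩)
  obtain ⟨θ, rfl⟩ := Module.projective_lifting_property π θ' hsurj
  obtain ⟨ρ, hρ⟩ := exists_eq_smul_of_comp_eq_zero hx hπ (ψ - θ ∘ₗ h) (by
    rw [LinearMap.comp_sub, hθ', LinearMap.comp_assoc, sub_self])
  refine ⟨ρ, ?_⟩
  ext a
  refine sub_eq_zero.mp (hx _ ?_)
  have h1 := LinearMap.congr_fun hψ a
  have h2 := LinearMap.congr_fun hρ (g a)
  have h3 := LinearMap.congr_fun hgh a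
  simp only [LinearMap.smul_apply, LinearMap.comp_apply, LinearMap.sub_apply,
    LinearMap.zero_apply] at h1 h2 h3 ⊢
  rw [smul_sub, h1, ← h2, h3, map_zero, sub_zero, sub_self]

include hx hπ in
lemma CochainExact.quotient [Module.Projective A P₁] (hsurj : Function.Surjective π)
    (hfg : g ∘ₗ f = 0) (H₁ : CochainExact f g M) (H₀ : CochainExact g h M) :
    CochainExact g h N := by
  intro φ' hφ'
  obtain ⟨φ, rfl⟩ := Module.projective_lifting_property π φ' hsurj
  obtain ⟨ρ, hρ⟩ := exists_eq_smul_of_comp_eq_zero hx hπ (φ ∘ₗ g) (by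
    rw [← LinearMap.comp_assoc, hφ'])
  obtain ⟨ψ, rfl⟩ := H₁ ρ (by
    ext a
    refine hx _ ?_
    have h1 := LinearMap.congr_fun hρ (f a)
    have h2 := LinearMap.congr_fun hfg a
    simp only [LinearMap.smul_apply, LinearMap.comp_apply, LinearMap.zero_apply] at h1 h2 ⊢
    rw [← h1, h2, map_zero])
  obtain ⟨η, hη⟩ := H₀ (φ - x • ψ) (by
    ext a
    have h1 := LinearMap.congr_fun hρ a
    simp only [LinearMap.smul_apply, LinearMap.comp_apply, LinearMap.sub_apply,
      LinearMap.zero_apply] at h1 ⊢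
    rw [h1, sub_self])
  refine ⟨π ∘ₗ η, ?_⟩
  rw [LinearMap.comp_assoc, ← hη]
  ext a
  have h1 : π (x • ψ a) = 0 := (hπ _).mpr ⟨_, rfl⟩
  simp [LinearMap.comp_apply, h1]

end CochainExact

section ExtVanishing

variable {A : Type} [CommRing A] [IsLocalRing A]
  (P : ProjectiveResolution (ModuleCat.of A (ResidueField A)))

/-- The degree `n` cohomology of `Hom(P, M)` vanishes. -/
def ExtVanishes (n : ℕ) (M : Type) [AddCommGroup M] [Module A M] : Prop :=
  CochainExact (P.complex.d (n + 1) n).hom (P.complex.d n ((ComplexShape.up ℕ).prev n)).hom M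

lemma extVanishes_iff (n : ℕ) (M : Type) [AddCommGroup M] [Module A M] :
    ExtVanishes P n M ↔ ¬ Nontrivial (((Ext A (ModuleCat A) n).obj
      (Opposite.op (ModuleCat.of A (ResidueField A)))).obj (ModuleCat.of A M)) := by
  rw [not_nontrivial_iff_subsingleton,
    (P.isoExt (R := A) n (ModuleCat.of A M)).toLinearEquiv.toEquiv.subsingleton_congr,
    ← ModuleCat.isZero_iff_subsingleton, ← HomologicalComplex.exactAt_iff_isZero_homology,
    HomologicalComplex.exactAt_iff' _ ((ComplexShape.up ℕ).prev n) n (n + 1) rfl (by simp),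
    ShortComplex.moduleCat_exact_iff]
  constructor
  · intro H φ hφ
    obtain ⟨ψ, hψ⟩ := H (ModuleCat.Hom.hom φ) (congrArg ModuleCat.Hom.hom hφ)
    exact ⟨ModuleCat.ofHom ψ, ModuleCat.hom_ext hψ.symm⟩
  · intro H φ hφ
    obtain ⟨ψ, hψ⟩ := H (ModuleCat.ofHom φ) (ModuleCat.hom_ext hφ)
    exact ⟨ModuleCat.Hom.hom ψ, (congrArg ModuleCat.Hom.hom hψ).symm⟩

end ExtVanishing

section ExtVanishingQuotient

variable {A : Type} [CommRing A] [IsLocalRing A]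
  (P : ProjectiveResolution (ModuleCat.of A (ResidueField A)))

lemma projective_complex_X (n : ℕ) : Module.Projective A (P.complex.X n) :=
  (IsProjective.iff_projective (P.complex.X n)).mpr (P.projective n)

lemma d_hom_comp_d_hom (i j k : ℕ) :
    (P.complex.d j k).hom ∘ₗ (P.complex.d i j).hom = 0 := by
  rw [← ModuleCat.hom_comp, P.complex.d_comp_d, ModuleCat.hom_zero]

omit P in
lemma smul_residueField_eq_zero {x : A} (hx : x ∈ maximalIdeal A) (v : ResidueField A) :
    x • v = 0 := by
  rw [Algebra.smul_def, ResidueField.algebraMap_eq, (residue_eq_zero_iff x).mpr hx, zero_mul]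

lemma exists_homotopy_smul {x : A} (hx : x ∈ maximalIdeal A) (n : ℕ) :
    ∃ (s : P.complex.X n →ₗ[A] P.complex.X (n + 1))
      (t : P.complex.X (n + 1) →ₗ[A] P.complex.X (n + 2)),
      ∀ a, x • a = s ((P.complex.d (n + 1) n).hom a) + (P.complex.d (n + 2) (n + 1)).hom (t a) := by
  have hcomm : (x • 𝟙 P.complex) ≫ P.π = 0 := by
    refine HomologicalComplex.to_single_hom_ext ?_
    ext a
    have h1 : x • (P.π.f 0).hom a = 0 := smul_residueField_eq_zero hx _
    rw [HomologicalComplex.comp_f, HomologicalComplex.smul_f_apply, HomologicalComplex.id_f,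
      Linear.smul_comp, Category.id_comp]
    exact h1
  have H := (ProjectiveResolution.liftHomotopyZero _ hcomm).comm (n + 1)
  rw [dNext_eq _ (show (ComplexShape.down ℕ).Rel (n + 1) n by simp),
    prevD_eq _ (show (ComplexShape.down ℕ).Rel (n + 2) (n + 1) by simp)] at H
  refine ⟨ModuleCat.Hom.hom ((ProjectiveResolution.liftHomotopyZero _ hcomm).hom n (n + 1)),
    ModuleCat.Hom.hom ((ProjectiveResolution.liftHomotopyZero _ hcomm).hom (n + 1) (n + 2)),
    fun a => ?_⟩
  have := LinearMap.congr_fun (congrArg ModuleCat.Hom.hom H) a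
  simpa using this

variable {M N : Type} [AddCommGroup M] [Module A M] [AddCommGroup N] [Module A N]

variable {P} in
lemma ExtVanishes.of_linearEquiv {n : ℕ} (e : M ≃ₗ[A] N) (H : ExtVanishes P n M) :
    ExtVanishes P n N :=
  CochainExact.of_linearEquiv e H

variable {P} {x : A} (hxm : x ∈ maximalIdeal A) (hx : ∀ v : M, x • v = 0 → v = 0) {π : M →ₗ[A] N}
  (hπ : ∀ v, π v = 0 ↔ ∃ w, v = x • w) (hsurj : Function.Surjective π) {n : ℕ}

include hxm hx hπ hsurj in
lemma ExtVanishes.of_quotient (H : ExtVanishes P n N) : ExtVanishes P (n + 1) M := by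
  have hprev : (ComplexShape.up ℕ).prev (n + 1) = n := by simp
  have := projective_complex_X P ((ComplexShape.up ℕ).prev n)
  rw [ExtVanishes, hprev]
  refine CochainExact.of_quotient hx hπ hsurj (d_hom_comp_d_hom P _ _ _) (fun φ hφ => ?_) H
  obtain ⟨s, t, hst⟩ := exists_homotopy_smul P hxm n
  refine ⟨φ ∘ₗ s, ?_⟩
  ext a
  have h1 := LinearMap.congr_fun hφ (t a)
  simp only [LinearMap.comp_apply, LinearMap.zero_apply, LinearMap.smul_apply] at h1 ⊢
  rw [← map_smul, hst, map_add, h1, add_zero]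

include hx hπ hsurj in
lemma ExtVanishes.quotient (H₁ : ExtVanishes P (n + 1) M) (H₀ : ExtVanishes P n M) :
    ExtVanishes P n N := by
  have hprev : (ComplexShape.up ℕ).prev (n + 1) = n := by simp
  have := projective_complex_X P n
  rw [ExtVanishes, hprev] at H₁
  exact CochainExact.quotient hx hπ hsurj (d_hom_comp_d_hom P _ _ _) H₁ H₀

lemma extVanishes_zero_iff :
    ExtVanishes P 0 M ↔ ∀ v : M, (∀ z ∈ maximalIdeal A, z • v = 0) → v = 0 := by
  have hprev : (ComplexShape.up ℕ).prev 0 = 0 := by simp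
  have hex := (ShortComplex.moduleCat_exact_iff _).mp P.exact₀
  rw [ExtVanishes, hprev]
  constructor
  · intro H v hv
    let ρ : ResidueField A →ₗ[A] M := Submodule.liftQ (maximalIdeal A)
      (LinearMap.toSpanSingleton A M v) fun z hz => hv z hz
    let π₀ : P.complex.X 0 →ₗ[A] ResidueField A := (P.π.f 0).hom
    obtain ⟨ψ, hψ⟩ := H (ρ ∘ₗ π₀) (by
      ext a
      have := LinearMap.congr_fun (congrArg ModuleCat.Hom.hom P.complex_d_comp_π_f_zero) a
      have h1 : π₀ ((P.complex.d 1 0).hom a) = 0 := this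
      simp only [LinearMap.comp_apply, LinearMap.zero_apply]
      rw [h1, map_zero])
    have hsurj : Function.Surjective π₀ := (ModuleCat.epi_iff_surjective _).mp inferInstance
    obtain ⟨a, ha⟩ := hsurj 1
    have h1 := LinearMap.congr_fun hψ a
    rw [P.complex.shape 0 0 (by simp), ModuleCat.hom_zero, LinearMap.comp_zero,
      LinearMap.comp_apply, ha] at h1
    have h2 : ρ 1 = (1 : A) • v := rfl
    rw [h2, one_smul] at h1
    exact h1
  · intro H φ hφ
    refine ⟨0, ?_⟩
    ext a
    refine H _ fun z hz => ?_
    obtain ⟨b, hb⟩ := hex (z • a)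
      ((map_smul (P.π.f 0).hom z a).trans (smul_residueField_eq_zero hz _))
    rw [← map_smul]
    have := LinearMap.congr_fun hφ b
    rw [← hb]
    exact this

end ExtVanishingQuotient

section PartialIdeal

variable {A : Type} [CommRing A] (x : ℕ → A) (j : ℕ)

/-- The projection `A / (x 0, …, x (j - 1)) → A / (x 0, …, x j)`. -/
def partialFactor : (A ⧸ partialIdeal x j) →ₗ[A] (A ⧸ partialIdeal x (j + 1)) :=
  Submodule.factor (partialIdeal_mono x (Nat.le_succ j))

lemma partialFactor_surjective : Function.Surjective (partialFactor x j) :=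
  Submodule.factor_surjective (partialIdeal_mono x (Nat.le_succ j))

lemma partialFactor_eq_zero_iff (v : A ⧸ partialIdeal x j) :
    partialFactor x j v = 0 ↔ ∃ w, v = x j • w := by
  obtain ⟨r, rfl⟩ := Submodule.Quotient.mk_surjective _ v
  have h1 : partialFactor x j (Submodule.Quotient.mk r) = Submodule.Quotient.mk r := rfl
  rw [h1, Submodule.Quotient.mk_eq_zero, mem_partialIdeal_succ]
  constructor
  · rintro ⟨t, ht, s, rfl⟩
    refine ⟨Submodule.Quotient.mk s, ?_⟩
    rw [← Submodule.Quotient.mk_smul, Submodule.Quotient.eq]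
    simpa using ht
  · rintro ⟨w, hw⟩
    obtain ⟨s, rfl⟩ := Submodule.Quotient.mk_surjective _ w
    rw [← Submodule.Quotient.mk_smul, Submodule.Quotient.eq] at hw
    exact ⟨_, hw, s, by simp⟩

variable {x j} in
lemma smul_eq_zero_of_cancel (h : ∀ r, x j * r ∈ partialIdeal x j → r ∈ partialIdeal x j)
    (v : A ⧸ partialIdeal x j) (hv : x j • v = 0) : v = 0 := by
  obtain ⟨r, rfl⟩ := Submodule.Quotient.mk_surjective _ v
  rw [← Submodule.Quotient.mk_smul, Submodule.Quotient.mk_eq_zero] at hv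
  exact (Submodule.Quotient.mk_eq_zero _).mpr (h r hv)

/-- `A / (0) ≃ A`. -/
def quotientPartialIdealZero : (A ⧸ partialIdeal x 0) ≃ₗ[A] A :=
  Submodule.quotEquivOfEqBot _ (partialIdeal_zero x)

end PartialIdeal

lemma ringKrullDim_quotient_add_one_le {B : Type} [CommRing B] {p Q : Ideal B} [p.IsPrime]
    (h : p ≤ Q) {y : B} (hyQ : y ∈ Q) (hyp : y ∉ p) :
    ringKrullDim (B ⧸ Q) + 1 ≤ ringKrullDim (B ⧸ p) := by
  refine ringKrullDim_succ_le_of_surjective (Ideal.Quotient.factor h)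
    (Ideal.Quotient.factor_surjective h) (r := Ideal.Quotient.mk p y)
    (mem_nonZeroDivisors_of_ne_zero ?_) ?_
  · rwa [Ne, Ideal.Quotient.eq_zero_iff_mem]
  · rw [Ideal.Quotient.factor_mk, Ideal.Quotient.eq_zero_iff_mem]
    exact hyQ

section Depth

variable {A : Type} [CommRing A] [IsLocalRing A]
  {P : ProjectiveResolution (ModuleCat.of A (ResidueField A))}

lemma extVanishes_of_lt_extDepth {i : ℕ} (h : (i : ℕ∞) < extDepth A) : ExtVanishes P i A := by
  rw [extVanishes_iff]
  exact fun hn => not_lt_of_ge (show extDepth A ≤ i from sInf_le ⟨i, rfl, hn⟩) h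

lemma extDepth_eq {d : ℕ} (h : ∀ i < d, ExtVanishes P i A) (hd : ¬ ExtVanishes P d A) :
    extDepth A = d := by
  refine le_antisymm (sInf_le ⟨d, rfl, ?_⟩) (le_sInf ?_)
  · rwa [extVanishes_iff, not_not] at hd
  · rintro _ ⟨i, rfl, hi⟩
    rw [Nat.cast_le]
    by_contra! hlt
    exact (extVanishes_iff P i A).mp (h i hlt) hi

lemma not_extVanishes_zero_quotient {q : Ideal A} (hq : q ≠ ⊤) {n : ℕ}
    (hn : maximalIdeal A ^ n ≤ q) : ¬ ExtVanishes P 0 (A ⧸ q) := by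
  rw [extVanishes_zero_iff]
  intro h
  apply hq
  have key : ∀ r, (∀ z ∈ maximalIdeal A, z * r ∈ q) → r ∈ q := fun r hr => by
    rw [← Submodule.Quotient.mk_eq_zero]
    refine h _ fun z hz => ?_
    rw [← Submodule.Quotient.mk_smul, Submodule.Quotient.mk_eq_zero]
    exact hr z hz
  suffices ∀ n, maximalIdeal A ^ n ≤ q → q = ⊤ from this n hn
  intro n
  induction n with
  | zero => simp
  | succ n ih =>
    exact fun hle => ih fun r hr => key r fun z hz =>
      hle (by rw [pow_succ']; exact Ideal.mul_mem_mul hz hr)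

theorem extDepth_eq_of_regular {d n : ℕ} {x : ℕ → A} (hx : ∀ i, x i ∈ maximalIdeal A)
    (hreg : ∀ j < d, ∀ r, x j * r ∈ partialIdeal x j → r ∈ partialIdeal x j)
    (hn : maximalIdeal A ^ n ≤ partialIdeal x d) : extDepth A = d := by
  let P := ProjectiveResolution.of (ModuleCat.of A (ResidueField A))
  have hne : partialIdeal x d ≠ ⊤ := by
    refine ne_top_of_le_ne_top (Ideal.IsPrime.ne_top (I := maximalIdeal A) inferInstance)
      (Ideal.span_le.mpr ?_)
    rintro _ ⟨i, -, rfl⟩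
    exact hx i
  have key : ∀ k j, j + k = d → (∀ i < k, ExtVanishes P i (A ⧸ partialIdeal x j)) ∧
      ¬ ExtVanishes P k (A ⧸ partialIdeal x j) := by
    intro k
    induction k with
    | zero =>
      rintro j rfl
      exact ⟨by simp, not_extVanishes_zero_quotient hne hn⟩
    | succ k ih =>
      intro j hj
      obtain ⟨h1, h2⟩ := ih (j + 1) (by omega)
      have hc := smul_eq_zero_of_cancel (hreg j (by omega))
      have h3 : ∀ i < k + 1, ExtVanishes P i (A ⧸ partialIdeal x j) := by
        rintro (_ | i) hi
        · exact extVanishes_zero_iff.mpr fun v hv => hc v (hv _ (hx j))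
        · exact (h1 i (by omega)).of_quotient (hx j) hc (partialFactor_eq_zero_iff x j)
            (partialFactor_surjective x j)
      exact ⟨h3, fun h4 => h2 (h4.quotient hc (partialFactor_eq_zero_iff x j)
        (partialFactor_surjective x j) (h3 k (by omega)))⟩
  obtain ⟨h1, h2⟩ := key d 0 (by omega)
  exact extDepth_eq (P := P) (fun i hi => (h1 i hi).of_linearEquiv (quotientPartialIdealZero x))
    fun h => h2 (h.of_linearEquiv (quotientPartialIdealZero x).symm)

variable [IsNoetherianRing A]

open scoped Pointwise in
lemma le_ringKrullDim_quotient_of_extVanishes {t : ℕ} (M : Type) [AddCommGroup M] [Module A M]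
    [Module.Finite A M] (h : ∀ i < t, ExtVanishes P i M) {p : Ideal A}
    (hp : p ∈ associatedPrimes A M) : (t : WithBot ℕ∞) ≤ ringKrullDim (A ⧸ p) := by
  induction t generalizing M p with
  | zero =>
    have := hp.1
    exact ringKrullDim_nonneg_of_nontrivial
  | succ t ih =>
    obtain ⟨y, hym, hy⟩ := exists_mem_maximalIdeal_forall_smul_eq_zero M
      (extVanishes_zero_iff.mp (h 0 (by omega)))
    have hpp := hp.1
    obtain ⟨-, v, hv⟩ := isAssociatedPrime_iff.mp hp
    let N : Submodule A M :=
      { carrier := {w | ∀ a ∈ p, a • w = 0}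
        add_mem' := fun ha hb c hc => by rw [smul_add, ha c hc, hb c hc, add_zero]
        zero_mem' := fun _ _ => smul_zero _
        smul_mem' := fun r w hw c hc => by rw [smul_comm, hw c hc, smul_zero] }
    have hvN : v ∈ N := fun a ha => by
      rwa [hv, Submodule.mem_colon_singleton, Submodule.mem_bot] at ha
    have hv0 : v ≠ 0 := by
      rintro rfl
      exact hpp.ne_top (hv.trans (by ext; simp [Submodule.mem_colon_singleton]))
    have hπ : ∀ w, (y • (⊤ : Submodule A M)).mkQ w = 0 ↔ ∃ u, w = y • u := fun w => by
      rw [Submodule.mkQ_apply, Submodule.Quotient.mk_eq_zero,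
        Submodule.mem_smul_pointwise_iff_exists]
      simp [eq_comm]
    obtain ⟨w, hwN, hw⟩ : ∃ w ∈ N, (y • (⊤ : Submodule A M)).mkQ w ≠ 0 := by
      by_contra! hcon
      have h1 : N ≤ maximalIdeal A • N := fun w hw => by
        obtain ⟨u, rfl⟩ := (hπ w).mp (hcon w hw)
        refine Submodule.smul_mem_smul hym fun a ha => hy _ ?_
        rw [smul_comm, hw a ha]
      have h2 := Submodule.eq_bot_of_le_smul_of_le_jacobson_bot (maximalIdeal A) N
        (IsNoetherian.noetherian _) h1 (IsLocalRing.maximalIdeal_le_jacobson _)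
      rw [h2] at hvN
      exact hv0 hvN
    obtain ⟨Q, hQ, hwQ⟩ := exists_le_isAssociatedPrime_of_isNoetherianRing A _ hw
    have hpQ : p ≤ Q := fun a ha => hwQ (by
      rw [Submodule.mem_colon_singleton, Submodule.mem_bot, ← map_smul, hwN a ha, map_zero])
    have hyQ : y ∈ Q := hwQ (by
      rw [Submodule.mem_colon_singleton, Submodule.mem_bot, ← map_smul]
      exact (hπ _).mpr ⟨w, rfl⟩)
    have hyp : y ∉ p := fun hyp => hv0 (hy v (hvN y hyp))
    have h3 := ih _ (fun i hi => (h (i + 1) (by omega)).quotient hy hπ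
      (Submodule.mkQ_surjective _) (h i (by omega))) hQ
    have h4 := ringKrullDim_quotient_add_one_le hpQ hyQ hyp
    push_cast
    exact (add_le_add_left h3 1).trans h4

end Depth

section RegularSequence

variable {A : Type} [CommRing A] [IsLocalRing A] [IsNoetherianRing A]

lemma ringKrullDim_quotient_le_sub {x : ℕ → A} (hx : ∀ i, x i ∈ maximalIdeal A) {d n k : ℕ}
    (hn : maximalIdeal A ^ n ≤ partialIdeal x d) {p : Ideal A} [p.IsPrime]
    (hp : partialIdeal x k ≤ p) : ringKrullDim (A ⧸ p) ≤ (d - k : ℕ) := by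
  classical
  have : IsLocalRing (A ⧸ p) := .of_surjective' (Ideal.Quotient.mk p) Ideal.Quotient.mk_surjective
  have hmap := map_maximalIdeal_of_surjective (Ideal.Quotient.mk p) Ideal.Quotient.mk_surjective
  have h1 := ringKrullDim_le_card_of_pow_le (A := A ⧸ p) (n := n)
    (s := (Finset.Ico k d).image fun i => Ideal.Quotient.mk p (x i)) (by
      intro a ha
      obtain ⟨i, -, rfl⟩ := Finset.mem_image.mp ha
      exact hmap ▸ Ideal.mem_map_of_mem _ (hx i)) (by
      refine (Ideal.pow_right_mono hmap.ge n).trans ?_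
      rw [← Ideal.map_pow]
      refine (Ideal.map_mono hn).trans ?_
      rw [partialIdeal, Ideal.map_span, Ideal.span_le]
      rintro _ ⟨_, ⟨i, hi, rfl⟩, rfl⟩
      rcases lt_or_ge i k with hik | hik
      · rw [Ideal.Quotient.eq_zero_iff_mem.mpr (hp (mem_partialIdeal x hik))]
        exact zero_mem _
      · refine Ideal.subset_span ?_
        simp only [Finset.coe_image, Finset.coe_Ico]
        exact ⟨i, ⟨hik, hi⟩, rfl⟩)
  refine h1.trans ?_
  have h2 := Finset.card_image_le (s := Finset.Ico k d) (f := fun i => Ideal.Quotient.mk p (x i))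
  rw [Nat.card_Ico] at h2
  exact_mod_cast h2

lemma cancel_of_extVanishes {P : ProjectiveResolution (ModuleCat.of A (ResidueField A))}
    {x : ℕ → A} (hx : ∀ i, x i ∈ maximalIdeal A) {d n : ℕ}
    (hn : maximalIdeal A ^ n ≤ partialIdeal x d) {j : ℕ} (hj : j < d)
    (h : ∀ i < d - j, ExtVanishes P i (A ⧸ partialIdeal x j)) (r : A)
    (hr : x j * r ∈ partialIdeal x j) : r ∈ partialIdeal x j := by
  by_contra hrn
  obtain ⟨p, hp, hle⟩ := exists_le_isAssociatedPrime_of_isNoetherianRing A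
    (Submodule.Quotient.mk r : A ⧸ partialIdeal x j)
    (by rwa [Ne, Submodule.Quotient.mk_eq_zero])
  have hmem : ∀ a, a * r ∈ partialIdeal x j → a ∈ p := fun a ha => hle (by
    rwa [Submodule.mem_colon_singleton, Submodule.mem_bot, ← Submodule.Quotient.mk_smul,
      Submodule.Quotient.mk_eq_zero])
  have hpp := hp.1
  have h1 := le_ringKrullDim_quotient_of_extVanishes _ h hp
  have h2 : partialIdeal x (j + 1) ≤ p := by
    rw [partialIdeal_succ]
    refine sup_le (fun a ha => hmem a (Ideal.mul_mem_right _ _ ha)) ?_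
    rw [Ideal.span_le, Set.singleton_subset_iff]
    exact hmem _ hr
  have h3 : d - j ≤ d - (j + 1) := by
    exact_mod_cast h1.trans (ringKrullDim_quotient_le_sub hx hn h2)
  omega

theorem cancel_of_le_extDepth {x : ℕ → A} (hx : ∀ i, x i ∈ maximalIdeal A) {d n : ℕ}
    (hn : maximalIdeal A ^ n ≤ partialIdeal x d) (hd : (d : ℕ∞) ≤ extDepth A) {j : ℕ} (hj : j < d) :
    ∀ r, x j * r ∈ partialIdeal x j → r ∈ partialIdeal x j := by
  let P := ProjectiveResolution.of (ModuleCat.of A (ResidueField A))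
  suffices ∀ k ≤ d, ∀ i < d - k, ExtVanishes P i (A ⧸ partialIdeal x k) from
    cancel_of_extVanishes hx hn hj (this j hj.le)
  intro k
  induction k with
  | zero =>
    intro _ i hi
    exact (extVanishes_of_lt_extDepth (P := P)
      (lt_of_lt_of_le (Nat.cast_lt.mpr hi) hd)).of_linearEquiv (quotientPartialIdealZero x).symm
  | succ k ih =>
    intro hk i hi
    have h := ih (by omega)
    exact (h (i + 1) (by omega)).quotient
      (smul_eq_zero_of_cancel (cancel_of_extVanishes hx hn (by omega) h))
      (partialFactor_eq_zero_iff x k) (partialFactor_surjective x k) (h i (by omega))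

omit [IsNoetherianRing A] in
lemma mem_maximalIdeal_mul_or_exists_isUnit (x : ℕ → A) (k : ℕ) {v : A}
    (hv : v ∈ partialIdeal x k) :
    v ∈ maximalIdeal A * partialIdeal x k ∨
      ∃ i < k, ∃ u, IsUnit u ∧ v - u * x i ∈ Ideal.span (x '' (Set.Iio k \ {i})) := by
  induction k generalizing v with
  | zero =>
    rw [partialIdeal_zero] at *
    exact Or.inl (by simpa using hv)
  | succ k ih =>
    obtain ⟨t, ht, r, rfl⟩ := mem_partialIdeal_succ.mp hv
    by_cases hr : IsUnit r
    · refine Or.inr ⟨k, by omega, r, hr, ?_⟩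
      rw [show t + x k * r - r * x k = t by ring]
      refine Ideal.span_mono (Set.image_mono fun a ha => ?_) ht
      simp only [Set.mem_Iio, Set.mem_sdiff, Set.mem_singleton_iff] at ha ⊢
      omega
    rcases ih ht with h | ⟨i, hi, u, hu, h⟩
    · refine Or.inl (add_mem (Ideal.mul_mono_right (partialIdeal_mono x (Nat.le_succ k)) h) ?_)
      exact mul_comm r (x k) ▸ Ideal.mul_mem_mul ((mem_maximalIdeal r).mpr hr)
        (mem_partialIdeal x (Nat.lt_succ_self k))
    · refine Or.inr ⟨i, by omega, u, hu, ?_⟩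
      rw [show t + x k * r - u * x i = (t - u * x i) + r * x k by ring]
      refine add_mem (Ideal.span_mono (Set.image_mono fun a ha => ?_) h)
        (Ideal.mul_mem_left _ _ (Ideal.subset_span ⟨k, ?_, rfl⟩))
      · simp only [Set.mem_Iio, Set.mem_sdiff, Set.mem_singleton_iff] at ha ⊢
        omega
      · simp only [Set.mem_Iio, Set.mem_sdiff, Set.mem_singleton_iff]
        omega

omit [IsLocalRing A] [IsNoetherianRing A] in
lemma partialIdeal_comp_swap (x : ℕ → A) {i k : ℕ} (hi : i < k + 1) :
    partialIdeal (x ∘ Equiv.swap i k) k = Ideal.span (x '' (Set.Iio (k + 1) \ {i})) := by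
  rw [partialIdeal, Set.image_comp]
  congr 2
  rw [Equiv.image_eq_preimage_symm, Equiv.symm_swap]
  ext a
  simp only [Set.mem_preimage, Set.mem_Iio, Set.mem_sdiff, Set.mem_singleton_iff,
    Equiv.swap_apply_def]
  split_ifs <;> omega

lemma mul_mem_maximalIdeal_mul_of_le_extDepth {d n : ℕ} (hdim : ringKrullDim A = d) (hd : 2 ≤ d)
    (hdep : (d : ℕ∞) ≤ extDepth A) {x : ℕ → A} (hx : ∀ i, x i ∈ maximalIdeal A)
    (hx2 : partialIdeal x d ≤ maximalIdeal A ^ 2)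
    (hn : maximalIdeal A ^ n ≤ partialIdeal x d) {c : A}
    (hc : ∀ z ∈ maximalIdeal A, z * c ∈ partialIdeal x d) :
    ∀ z ∈ maximalIdeal A, z * c ∈ maximalIdeal A * partialIdeal x d := by
  intro z hz
  refine (mem_maximalIdeal_mul_or_exists_isUnit x d (hc z hz)).resolve_right ?_
  rintro ⟨i, hi, u, hu, hzc⟩
  obtain ⟨d, rfl⟩ : ∃ k, d = k + 1 := ⟨d - 1, by omega⟩
  rw [← partialIdeal_comp_swap x hi] at hzc
  set x' := x ∘ Equiv.swap i d with hx'
  have hlast : x' d = x i := by simp [hx']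
  have heq : partialIdeal x' (d + 1) = partialIdeal x (d + 1) := by
    rw [partialIdeal_succ, hlast, partialIdeal_comp_swap x hi, ← Ideal.span_union, partialIdeal,
      ← Set.image_singleton, ← Set.image_union, Set.sdiff_union_of_subset]
    simpa using hi
  have hreg := cancel_of_le_extDepth (x := x') (fun j => hx _) (heq ▸ hn) hdep (Nat.lt_succ_self d)
  rw [hlast] at hreg
  have hcreg : ∀ t, c * t ∈ partialIdeal x' d → t ∈ partialIdeal x' d := fun t ht => by
    refine hreg t ((Ideal.unit_mul_mem_iff_mem _ hu).mp ?_)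
    rw [show u * (x i * t) = z * (c * t) - t * (z * c - u * x i) by ring]
    exact sub_mem (Ideal.mul_mem_left _ _ ht) (Ideal.mul_mem_left _ _ hzc)
  have hle : maximalIdeal A ≤ Ideal.span {z} ⊔ maximalIdeal A • maximalIdeal A := by
    intro z' hz'
    have h1 := hc z' hz'
    rw [← heq, mem_partialIdeal_succ, hlast] at h1
    obtain ⟨t, ht, s, hs⟩ := h1
    have h2 := hcreg (u * z' - s * z) (by
      rw [show c * (u * z' - s * z) = u * t - s * (z * c - u * x i) by linear_combination u * hs]
      exact sub_mem (Ideal.mul_mem_left _ _ ht) (Ideal.mul_mem_left _ _ hzc))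
    refine (Ideal.unit_mul_mem_iff_mem _ hu).mp ?_
    rw [show u * z' = s * z + (u * z' - s * z) by ring]
    refine add_mem (Ideal.mem_sup_left (Ideal.mul_mem_left _ _ (Ideal.mem_span_singleton_self z)))
      (Ideal.mem_sup_right ?_)
    rw [smul_eq_mul, ← sq]
    exact hx2 (heq ▸ partialIdeal_mono x' (Nat.le_succ d) h2)
  have h3 := Submodule.le_of_le_smul_of_le_jacobson_bot (IsNoetherian.noetherian _)
    (IsLocalRing.maximalIdeal_le_jacobson _) hle
  have := le_of_pow_le_partialIdeal_sup hdim hx hz (j := 0) (n := 1)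
    (by rw [pow_one]; exact h3.trans le_sup_right)
  omega

end RegularSequence

section IndexOfReducibility

variable {A : Type} [CommRing A] [IsLocalRing A] [IsNoetherianRing A]

lemma IsParameterIdeal.exists_partialIdeal {d : ℕ} {q : Ideal A} (hq : IsParameterIdeal A d q) :
    ∃ (x : ℕ → A) (n : ℕ), q = partialIdeal x d ∧ (∀ i, x i ∈ maximalIdeal A) ∧
      maximalIdeal A ^ n ≤ q := by
  obtain ⟨⟨x, rfl⟩, hrad⟩ := hq
  obtain ⟨n, hn⟩ := Ideal.exists_pow_le_of_le_radical_of_fg hrad.ge (IsNoetherian.noetherian _)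
  refine ⟨fun i => if h : i < d then x ⟨i, h⟩ else 0, n, ?_, fun i => ?_, hn⟩
  · rw [partialIdeal]
    congr 1
    ext a
    constructor
    · rintro ⟨i, rfl⟩
      exact ⟨i, i.2, by simp⟩
    · rintro ⟨i, hi, rfl⟩
      have hi' : i < d := hi
      exact ⟨⟨i, hi'⟩, by simp [hi']⟩
  · dsimp only
    split_ifs with h
    · exact hrad ▸ Ideal.le_radical (Ideal.subset_span ⟨_, rfl⟩)
    · exact zero_mem _

theorem indexOfReducibility_eq_of_le_extDepth {d : ℕ} (hdim : ringKrullDim A = d) (hd : 2 ≤ d)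
    (hdep : (d : ℕ∞) ≤ extDepth A) {q : Ideal A} (hq : IsParameterIdeal A d q)
    (hq2 : q ≤ maximalIdeal A ^ 2) {eI eQ : ℕ → ℤ}
    (hI : IsHilbertCoeffs A d (q.colon (maximalIdeal A)) eI) (hQ : IsHilbertCoeffs A d q eQ)
    {N : ℕ} (hN : indexOfReducibility A q = (N : ℕ∞)) : (N : ℤ) = eI 1 - eQ 1 := by
  obtain ⟨x, n, hqx, hx, hn⟩ := hq.exists_partialIdeal
  have hcancel := fun j (hj : j < d) => cancel_of_le_extDepth hx (hqx ▸ hn) hdep hj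
  have hT : IsTower x (partialIdeal x) d :=
    ⟨fun _ _ => le_rfl, fun _ _ hij _ => partialIdeal_mono x hij, hcancel,
      fun _ _ _ hu => Ideal.mul_mem_left _ _ hu⟩
  have hqI := le_colon_maximalIdeal q
  obtain ⟨e, e', he, he', h1⟩ := hT.exists_hilbertCoeffs (by omega) hqx
    (fun u => mem_colon_maximalIdeal) (fun i hi u hu => by
      rw [sup_eq_left.mpr (hqx ▸ partialIdeal_mono x hi.le)] at hu
      exact Ideal.mem_sup_left (mem_colon_maximalIdeal.mpr hu))
    (colon_maximalIdeal_le hdim (by omega) hq2)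
    (Ideal.mul_le.mpr fun z hz c hc => by
      subst hqx
      exact mul_mem_maximalIdeal_mul_of_le_extDepth hdim hd hdep hx hq2 hn
        (mem_colon_maximalIdeal.mp hc) z hz) hn
  have hle : partialIdeal x (d - 1) ≤ q := hqx ▸ partialIdeal_mono x (Nat.sub_le d 1)
  rw [sup_eq_right.mpr hle, sup_eq_right.mpr (hle.trans hqI)] at h1
  have h2 := indexOfReducibility_eq hn hN
  have huniq : ∀ {J : Ideal A} {f g : ℕ → ℤ}, maximalIdeal A ^ n ≤ J →
      IsHilbertCoeffs A d J f → IsHilbertCoeffs A d J g → f 1 = g 1 := fun hJ hf hg => by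
    obtain ⟨N₁, hf⟩ := (isHilbertCoeffs_iff hJ d _).mp hf
    obtain ⟨N₂, hg⟩ := (isHilbertCoeffs_iff hJ d _).mp hg
    exact hilbertValue_unique hf hg 1 (by omega)
  rw [huniq (hn.trans hqI) hI he', huniq hn hQ he, h1]
  omega

end IndexOfReducibility

/-- Theorem 1.1 / Theorem 3.6: for an unmixed Noetherian local ring of dimension `d ≥ 2`
with infinite residue field, `R` is Cohen–Macaulay iff `𝒩(𝔮;R) = e₁(𝔮:𝔪) - e₁(𝔮)` for all
parameter ideals `𝔮 ⊆ 𝔪²`, iff `𝒩(𝔮;R) ≤ e₁(𝔮:𝔪) - e₁(𝔮)` for all parameter ideals `𝔮 ⊆ 𝔪²`. -/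
theorem stmt_0 [IsNoetherianRing R] (d : ℕ)
    (hdim : ringKrullDim R = (d : WithBot ℕ∞)) (hd : 2 ≤ d)
    (hres : Infinite (ResidueField R)) (hunmixed : IsUnmixed R d) :
    [ IsCohenMacaulay R,
      ∀ q : Ideal R, IsParameterIdeal R d q → q ≤ maximalIdeal R ^ 2 →
        ∀ eI eQ : ℕ → ℤ, IsHilbertCoeffs R d (q.colon (maximalIdeal R)) eI →
          IsHilbertCoeffs R d q eQ →
          ∀ Nq : ℕ, indexOfReducibility R q = (Nq : ℕ∞) → (Nq : ℤ) = eI 1 - eQ 1,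
      ∀ q : Ideal R, IsParameterIdeal R d q → q ≤ maximalIdeal R ^ 2 →
        ∀ eI eQ : ℕ → ℤ, IsHilbertCoeffs R d (q.colon (maximalIdeal R)) eI →
          IsHilbertCoeffs R d q eQ →
          ∀ Nq : ℕ, indexOfReducibility R q = (Nq : ℕ∞) → (Nq : ℤ) ≤ eI 1 - eQ 1 ].TFAE := by
  tfae_have 1 → 2 := fun h q hq hq2 eI eQ hI hQ N hN => by
    rw [IsCohenMacaulay, hdim] at h
    exact indexOfReducibility_eq_of_le_extDepth hdim hd (WithBot.coe_injective h).ge hq hq2 hI hQ hN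
  tfae_have 2 → 3 := fun h q hq hq2 eI eQ hI hQ N hN => (h q hq hq2 eI eQ hI hQ N hN).le
  tfae_have 3 → 1 := fun h => by
    obtain ⟨x, n, hx, hreg, hn⟩ := exists_regular_of_indexOfReducibility_le hdim hd h
    rw [IsCohenMacaulay, hdim, extDepth_eq_of_regular hx hreg hn]
    rfl
  tfae_finish

end
end

section
/- Let (R, 𝔪) be a Noetherian local ring of dimension d > 0 with infinite residue field, and let 𝔮 = (x₁, …, x_d) be a parameter ideal of R such that I² = 𝔮I, where I = 𝔮 :_R 𝔪. Then e₁(I) − e₁(𝔮) ≤ f₀(𝔮). -/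
open CategoryTheory IsLocalRing

noncomputable section

variable (R : Type) [CommRing R] [IsLocalRing R]

theorem moduleLength_eq_length (R M : Type) [CommRing R] [AddCommGroup M] [Module R M] :
    moduleLength R M = Module.length R M :=
  (Module.coe_length R M).symm

theorem length_quotient_antitone {A : Type} [CommRing A] {Q J : Ideal A} (h : Q ≤ J) :
    Module.length A (A ⧸ J) ≤ Module.length A (A ⧸ Q) :=
  Module.length_le_of_surjective (Submodule.factor h) (Submodule.factor_surjective h)

theorem length_quotient_eq_add {A : Type} [CommRing A] {Q C : Ideal A} (h : Q ≤ C) :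
    Module.length A (A ⧸ Q) =
      Module.length A (C ⧸ Submodule.comap C.subtype Q) + Module.length A (A ⧸ C) := by
  refine Module.length_eq_add_of_exact
    (Submodule.mapQ (Submodule.comap C.subtype Q) Q C.subtype le_rfl)
    (Submodule.factor h) ?_ (Submodule.factor_surjective h) ?_
  · rw [← LinearMap.ker_eq_bot, Submodule.ker_mapQ]
    simp
  · rw [LinearMap.exact_iff, Submodule.range_mapQ, Submodule.range_subtype, Submodule.factor,
      Submodule.ker_mapQ, Submodule.comap_id]

/-- If `Q ≤ J ≤ C`, then `ℓ(A/Q) ≤ ℓ(C/Q) + ℓ(A/J)`. -/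
theorem length_quotient_le_add {A : Type} [CommRing A] {Q J C : Ideal A} (hQJ : Q ≤ J)
    (hJC : J ≤ C) :
    Module.length A (A ⧸ Q) ≤
      Module.length A (C ⧸ Submodule.comap C.subtype Q) + Module.length A (A ⧸ J) := by
  rw [length_quotient_eq_add (hQJ.trans hJC)]
  gcongr
  exact length_quotient_antitone hJC

/-- A colon ideal `I = q : 𝔞` with `I² = qI` satisfies `Iⁿ⁺¹ = qⁿI`, hence
`Iⁿ⁺¹ ⊆ qⁿ⁺¹ : 𝔞`. -/
theorem colon_pow_succ_le {A : Type} [CommRing A] {q a : Ideal A}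
    (h : (q.colon (a : Set A)) ^ 2 = q * q.colon (a : Set A)) (n : ℕ) :
    (q.colon (a : Set A)) ^ (n + 1) ≤ (q ^ (n + 1)).colon (a : Set A) := by
  have hpow : (q.colon (a : Set A)) ^ (n + 1) = q ^ n * q.colon (a : Set A) := by
    induction n with
    | zero => simp
    | succ n ih => rw [pow_succ, ih, mul_assoc, ← pow_two, h, ← mul_assoc, ← pow_succ]
  rw [hpow, Ideal.mul_le]
  intro r hr s hs
  rw [Submodule.mem_colon] at hs ⊢
  intro p hp
  rw [smul_eq_mul, mul_assoc, pow_succ]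
  exact Ideal.mul_mem_mul hr (hs p hp)

open Filter Topology in
theorem tendsto_choose_div_pow (c k : ℕ) :
    Tendsto (fun n : ℕ => ((n + c + k).choose k : ℝ) / (n : ℝ) ^ k) atTop
      (𝓝 (1 / (k.factorial : ℝ))) := by
  induction k with
  | zero => simp
  | succ k ih =>
    have hlin : Tendsto (fun n : ℕ => ((n : ℝ) + (c + k + 1)) / n) atTop (𝓝 1) := by
      have h := (tendsto_const_div_atTop_nhds_zero_nat ((c : ℝ) + k + 1)).const_add 1
      rw [add_zero] at h
      refine h.congr' ?_
      filter_upwards [eventually_ne_atTop 0] with n hn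
      field_simp
    have h := (ih.mul hlin).div_const ((k : ℝ) + 1)
    have hlim : 1 / (k.factorial : ℝ) * 1 / ((k : ℝ) + 1) = 1 / ((k + 1).factorial : ℝ) := by
      rw [Nat.factorial_succ]
      push_cast
      field_simp
    rw [hlim] at h
    refine h.congr fun n => ?_
    have hc := Nat.add_one_mul_choose_eq (n + c + k) k
    have hc' : ((n : ℝ) + c + k + 1) * ((n + c + k).choose k : ℝ)
        = ((n + c + (k + 1)).choose (k + 1) : ℝ) * ((k : ℝ) + 1) := by
      exact_mod_cast hc
    rw [eq_div_of_mul_eq (by positivity) hc'.symm, pow_succ]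
    ring

open Filter Topology in
/-- The normalized leading coefficient of a polynomial written in the binomial basis. -/
theorem tendsto_sum_choose_div_pow (c D : ℕ) (g : ℕ → ℤ) :
    Tendsto (fun n : ℕ => ((∑ i ∈ Finset.range (D + 1),
        (-1 : ℤ) ^ i * g i * ((n + c + D - i).choose (D - i) : ℤ) : ℤ) : ℝ) / (n : ℝ) ^ D) atTop
      (𝓝 (g 0 / (D.factorial : ℝ))) := by
  have hterm : ∀ i ∈ Finset.range (D + 1), Tendsto (fun n : ℕ =>
      (-1 : ℝ) ^ i * g i * ((n + c + D - i).choose (D - i) : ℝ) / (n : ℝ) ^ D) atTop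
      (𝓝 (if i = 0 then g 0 / (D.factorial : ℝ) else 0)) := by
    intro i hi
    have hiD : i ≤ D := Nat.lt_succ_iff.mp (Finset.mem_range.mp hi)
    have h := (tendsto_choose_div_pow c (D - i)).const_mul ((-1 : ℝ) ^ i * g i)
    have hsub : ∀ n : ℕ, n + c + (D - i) = n + c + D - i := fun n => by omega
    simp only [hsub] at h
    split_ifs with h0
    · subst h0
      simpa [mul_assoc, div_eq_mul_inv] using h
    · have hz := h.mul ((tendsto_inv_atTop_nhds_zero_nat (𝕜 := ℝ)).pow i)
      rw [zero_pow h0, mul_zero] at hz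
      refine hz.congr fun n => ?_
      obtain ⟨j, rfl⟩ := Nat.exists_eq_add_of_le hiD
      rw [Nat.add_sub_cancel_left, pow_add, inv_pow]
      rw [mul_div_assoc, mul_assoc, div_mul_eq_mul_div, div_eq_mul_inv, div_eq_mul_inv, mul_inv]
      ring
  have hsum := tendsto_finsetSum _ hterm
  simp only [Finset.sum_ite_eq', Finset.mem_range, Nat.succ_pos, if_true] at hsum
  refine hsum.congr fun n => ?_
  push_cast
  rw [Finset.sum_div]

open Filter in
/-- The leading coefficient is monotone. -/
theorem leading_coeff_le_of_eventually_le (c c' D : ℕ) (g g' : ℕ → ℤ)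
    (h : ∀ᶠ n : ℕ in atTop,
      ∑ i ∈ Finset.range (D + 1), (-1 : ℤ) ^ i * g i * ((n + c + D - i).choose (D - i) : ℤ) ≤
      ∑ i ∈ Finset.range (D + 1), (-1 : ℤ) ^ i * g' i * ((n + c' + D - i).choose (D - i) : ℤ)) :
    g 0 ≤ g' 0 := by
  have key : (g 0 : ℝ) / (D.factorial : ℝ) ≤ (g' 0 : ℝ) / (D.factorial : ℝ) := by
    refine le_of_tendsto_of_tendsto (tendsto_sum_choose_div_pow c D g)
      (tendsto_sum_choose_div_pow c' D g') ?_
    filter_upwards [h] with n hn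
    gcongr
  rw [div_le_div_iff_of_pos_right (by positivity)] at key
  exact_mod_cast key

open Filter Topology in
/-- A polynomial squeezed between `0` and a polynomial of degree one less has vanishing leading
coefficient, and then its next coefficient is bounded by the leading one of the upper bound. -/
theorem second_coeff_le_of_eventually_bounded (c D : ℕ) (a f : ℕ → ℤ)
    (h0 : ∀ᶠ n : ℕ in atTop, 0 ≤ ∑ i ∈ Finset.range (D + 2),
      (-1 : ℤ) ^ i * a i * ((n + (D + 1) - i).choose (D + 1 - i) : ℤ))
    (h1 : ∀ᶠ n : ℕ in atTop, ∑ i ∈ Finset.range (D + 2),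
      (-1 : ℤ) ^ i * a i * ((n + (D + 1) - i).choose (D + 1 - i) : ℤ) ≤
      ∑ i ∈ Finset.range (D + 1), (-1 : ℤ) ^ i * f i * ((n + c + D - i).choose (D - i) : ℤ)) :
    a 0 = 0 ∧ -a 1 ≤ f 0 := by
  have ha := tendsto_sum_choose_div_pow 0 (D + 1) a
  simp only [add_zero] at ha
  have ha0 : a 0 = 0 := by
    have hf := (tendsto_sum_choose_div_pow c D f).mul
      (tendsto_inv_atTop_nhds_zero_nat (𝕜 := ℝ))
    rw [mul_zero] at hf
    have hle : (a 0 : ℝ) / ((D + 1).factorial : ℝ) ≤ 0 := by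
      refine le_of_tendsto_of_tendsto ha hf ?_
      filter_upwards [h1] with n hn
      rw [div_mul_eq_mul_div, ← div_eq_mul_inv, div_div, ← pow_succ']
      gcongr
    have hge : 0 ≤ (a 0 : ℝ) / ((D + 1).factorial : ℝ) := by
      refine ge_of_tendsto ha ?_
      filter_upwards [h0] with n hn
      have : (0 : ℝ) ≤ ((∑ i ∈ Finset.range (D + 1 + 1),
        (-1 : ℤ) ^ i * a i * ((n + (D + 1) - i).choose (D + 1 - i) : ℤ) : ℤ) : ℝ) := by
        exact_mod_cast hn
      positivity
    have hzero := (div_eq_zero_iff.mp (le_antisymm hle hge)).resolve_right (by positivity)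
    exact_mod_cast hzero
  refine ⟨ha0, leading_coeff_le_of_eventually_le 0 c D (fun i => -a (i + 1)) f ?_⟩
  filter_upwards [h1] with n hn
  rw [Finset.sum_range_succ', ha0] at hn
  convert hn using 1
  simp only [mul_zero, zero_mul, add_zero]
  refine Finset.sum_congr rfl fun i _ => ?_
  rw [← add_assoc n D 1, Nat.add_sub_add_right, Nat.add_sub_add_right]
  ring

/-- Proposition 2.3: if `𝔮` is a parameter ideal of a Noetherian local ring of positive
dimension with infinite residue field such that `I² = 𝔮I`, where `I = 𝔮 :_R 𝔪`, then
`e₁(I) - e₁(𝔮) ≤ f₀(𝔮)`. -/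
theorem stmt_5 [IsNoetherianRing R] (d : ℕ)
    (hdim : ringKrullDim R = (d : WithBot ℕ∞)) (hd : 0 < d)
    (hres : Infinite (ResidueField R))
    (q : Ideal R) (hq : IsParameterIdeal R d q)
    (hqI : (q.colon (maximalIdeal R)) ^ 2 = q * (q.colon (maximalIdeal R))) :
    ∀ eI eQ f : ℕ → ℤ, IsHilbertCoeffs R d (q.colon (maximalIdeal R)) eI →
      IsHilbertCoeffs R d q eQ → IsIrrCoeffs R d q f →
      eI 1 - eQ 1 ≤ f 0 := by
  rintro eI eQ f ⟨N₁, h₁⟩ ⟨N₂, h₂⟩ ⟨N₃, h₃⟩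
  obtain ⟨D, rfl⟩ := Nat.exists_eq_succ_of_ne_zero hd.ne'
  have hbound : ∀ n ≥ N₁ + N₂ + N₃,
      0 ≤ ∑ i ∈ Finset.range (D + 2),
        (-1 : ℤ) ^ i * (eQ i - eI i) * ((n + (D + 1) - i).choose (D + 1 - i) : ℤ) ∧
      ∑ i ∈ Finset.range (D + 2),
        (-1 : ℤ) ^ i * (eQ i - eI i) * ((n + (D + 1) - i).choose (D + 1 - i) : ℤ) ≤
      ∑ i ∈ Finset.range (D + 1),
        (-1 : ℤ) ^ i * f i * ((n + 1 + D - i).choose (D - i) : ℤ) := by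
    intro n hn
    obtain ⟨LI, hLI, hI⟩ := h₁ n (by omega)
    obtain ⟨LQ, hLQ, hQ⟩ := h₂ n (by omega)
    obtain ⟨Lf, hLf, hf⟩ := h₃ (n + 1) (by omega)
    rw [indexOfReducibility, moduleLength_eq_length, WithBot.coe_inj] at hLf
    rw [moduleLength_eq_length, WithBot.coe_inj] at hLI hLQ
    have hqJ : q ^ (n + 1) ≤ q.colon (maximalIdeal R : Set R) ^ (n + 1) :=
      Ideal.pow_right_mono Ideal.le_colon (n + 1)
    have hlow := length_quotient_antitone hqJ
    have hup := length_quotient_le_add hqJ (colon_pow_succ_le hqI n)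
    rw [hLI, hLQ] at hlow
    rw [hLI, hLQ, hLf] at hup
    have hlow' : LI ≤ LQ := by exact_mod_cast hlow
    have hup' : LQ ≤ Lf + LI := by exact_mod_cast hup
    have hdiff : ∑ i ∈ Finset.range (D + 2),
        (-1 : ℤ) ^ i * (eQ i - eI i) * ((n + (D + 1) - i).choose (D + 1 - i) : ℤ)
        = (LQ : ℤ) - LI := by
      rw [hI, hQ, ← Finset.sum_sub_distrib]
      exact Finset.sum_congr rfl fun i _ => by ring
    have hf' : ∑ i ∈ Finset.range (D + 1),
        (-1 : ℤ) ^ i * f i * ((n + 1 + D - i).choose (D - i) : ℤ) = Lf := hf.symm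
    rw [hdiff, hf']
    omega
  have hev := Filter.eventually_atTop.mpr ⟨_, hbound⟩
  have hle := (second_coeff_le_of_eventually_bounded 1 D (fun i => eQ i - eI i) f
    (hev.mono fun _ h => h.1) (hev.mono fun _ h => h.2)).2
  linarith

end
end
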